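/- Let r₀ : ℝ → ℝ be a smooth, strictly positive, 2π-periodic function. Then the Cauchy problem for the quasilinear parabolic equation ∂r/∂t = (1/g²)∂²r/∂θ² − (2/(r g²))(∂r/∂θ)² − r/g² + 2πg/(rL), with g = √(r² + (∂r/∂θ)²), L(t) = ∫₀^{2π} g dθ, and initial value r(·,0) = r₀, has a unique smooth positive solution r(θ,t), 2π-periodic in θ, on [0,2π] × [0,ω) for some ω > 0. Consequently, Gage's area-preserving flow with a smooth star-shaped initial curve has a unique smooth solution on some time interval [0, ω), ω > 0. -/

import Mathlib

open Real Set MeasureTheory Filter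

noncomputable section

/-- Euclidean norm of a plane vector. -/
def vnorm (v : ℝ × ℝ) : ℝ := Real.sqrt (v.1 ^ 2 + v.2 ^ 2)

/-- Determinant of the 2×2 matrix whose rows are the plane vectors `a`, `b`. -/
def vdet (a b : ℝ × ℝ) : ℝ := a.1 * b.2 - a.2 * b.1

/-- Unit tangent vector of a plane curve. -/
def unitTangent (X : ℝ → ℝ × ℝ) (φ : ℝ) : ℝ × ℝ :=
  (vnorm (deriv X φ))⁻¹ • deriv X φ

/-- Inward unit normal: the rotation of the unit tangent by +π/2. -/
def innerNormal (X : ℝ → ℝ × ℝ) (φ : ℝ) : ℝ × ℝ :=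
  (-(unitTangent X φ).2, (unitTangent X φ).1)

/-- Curvature of a plane curve. -/
def curv (X : ℝ → ℝ × ℝ) (φ : ℝ) : ℝ :=
  vdet (deriv X φ) (deriv (deriv X) φ) / vnorm (deriv X φ) ^ 3

/-- Length of a closed plane curve parametrized on `[0, 2π]`. -/
def clen (X : ℝ → ℝ × ℝ) : ℝ := ∫ φ in (0:ℝ)..(2 * π), vnorm (deriv X φ)

/-- Enclosed area of a closed plane curve. -/
def carea (X : ℝ → ℝ × ℝ) : ℝ :=
  (1 / 2) * ∫ φ in (0:ℝ)..(2 * π), vdet (X φ) (deriv X φ)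

/-- A smooth closed plane curve: a smooth `2π`-periodic map `ℝ → ℝ²` with
nonvanishing derivative. -/
structure IsSmoothClosedCurve (X : ℝ → ℝ × ℝ) : Prop where
  smooth : ContDiff ℝ (⊤ : ℕ∞) X
  periodic : Function.Periodic X (2 * π)
  regular : ∀ φ, deriv X φ ≠ 0

/-- An embedded closed curve: injective over one period. -/
def IsEmbeddedCurve (X : ℝ → ℝ × ℝ) : Prop := Set.InjOn X (Set.Ico 0 (2 * π))

/-- Star-shapedness with respect to a point `O`: `det(X − O, T) > 0` everywhere. -/
def StarShapedWrt (X : ℝ → ℝ × ℝ) (O : ℝ × ℝ) : Prop :=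
  ∀ φ, 0 < vdet (X φ - O) (unitTangent X φ)

/-- Centrosymmetry with respect to a point `O`: the image of the curve is invariant
under the point reflection `Z ↦ 2O − Z`. -/
def CentroSymmetricWrt (X : ℝ → ℝ × ℝ) (O : ℝ × ℝ) : Prop :=
  (fun Z => (2 : ℝ) • O - Z) '' Set.range X = Set.range X

/-- `X` is a smooth solution of Gage's area-preserving flow on the time set `I`
with initial curve `X₀`: `∂X/∂t = α T + (κ − 2π/L) N`. -/
structure IsGAPFSolutionOn (X : ℝ → ℝ → ℝ × ℝ) (X₀ : ℝ → ℝ × ℝ) (I : Set ℝ) : Prop where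
  init : ∀ φ, X 0 φ = X₀ φ
  curve : ∀ t ∈ I, IsSmoothClosedCurve (X t)
  smooth : ContDiffOn ℝ (⊤ : ℕ∞) (fun p : ℝ × ℝ => X p.1 p.2) (I ×ˢ Set.univ)
  flow : ∃ α : ℝ → ℝ → ℝ,
    ∀ t ∈ I, ∀ φ,
      HasDerivWithinAt (fun τ => X τ φ)
        (α t φ • unitTangent (X t) φ +
          (curv (X t) φ - 2 * π / clen (X t)) • innerNormal (X t) φ) I t
/-- First partial derivative in `θ` of a radial function `r(θ, t)`. -/
def rdθ (r : ℝ → ℝ → ℝ) (θ t : ℝ) : ℝ := deriv (fun u => r u t) θ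

/-- Second partial derivative in `θ` of a radial function `r(θ, t)`. -/
def rdθθ (r : ℝ → ℝ → ℝ) (θ t : ℝ) : ℝ := deriv (deriv (fun u => r u t)) θ

/-- The metric `g = √(r² + (∂r/∂θ)²)` of the polar curve with radial function `r`. -/
def rmet (r : ℝ → ℝ → ℝ) (θ t : ℝ) : ℝ := Real.sqrt (r θ t ^ 2 + rdθ r θ t ^ 2)

/-- The length `L(t) = ∫₀^{2π} g dθ` of the polar curve with radial function `r`. -/
def rlen (r : ℝ → ℝ → ℝ) (t : ℝ) : ℝ := ∫ θ in (0:ℝ)..(2 * π), rmet r θ t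

/-- The radial equation of Gage's area-preserving flow
`∂r/∂t = (1/g²) ∂²r/∂θ² − (2/(r g²)) (∂r/∂θ)² − r/g² + 2πg/(rL)` on the time set `I`. -/
def RadialGAPF (r : ℝ → ℝ → ℝ) (I : Set ℝ) : Prop :=
  ∀ t ∈ I, ∀ θ : ℝ,
    HasDerivWithinAt (fun τ => r θ τ)
      (rdθθ r θ t / rmet r θ t ^ 2 - 2 / (r θ t * rmet r θ t ^ 2) * rdθ r θ t ^ 2
        - r θ t / rmet r θ t ^ 2 + 2 * π * rmet r θ t / (r θ t * rlen r t)) I t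

/-- The radial equation of the curve shortening flow
`∂ρ/∂t = (1/g²) ∂²ρ/∂θ² − (2/(ρ g²)) (∂ρ/∂θ)² − ρ/g²` on the time set `I`. -/
def RadialCSF (ρ : ℝ → ℝ → ℝ) (I : Set ℝ) : Prop :=
  ∀ t ∈ I, ∀ θ : ℝ,
    HasDerivWithinAt (fun τ => ρ θ τ)
      (rdθθ ρ θ t / rmet ρ θ t ^ 2 - 2 / (ρ θ t * rmet ρ θ t ^ 2) * rdθ ρ θ t ^ 2
        - ρ θ t / rmet ρ θ t ^ 2) I t

namespace GP

/-- Submultiplicative weights on `ℤ` growing faster than every polynomial. -/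
structure Weight where
  w : ℤ → ℝ
  pos : ∀ k, 0 < w k
  submul : ∀ j k, w (j + k) ≤ w j * w k
  symm : ∀ k, w (-k) = w k
  growth : ∀ m : ℕ, ∃ C : ℝ, 0 ≤ C ∧ ∀ k : ℤ, |(k : ℝ)| ^ m ≤ C * w k

/-- Submultiplicative minorant of a positive sequence. -/
theorem exists_submul_seq (b : ℕ → ℝ) (hb : ∀ n, 0 < b n) :
    ∃ d : ℕ → ℝ, d 0 = 1 ∧ (∀ n, 0 < d n) ∧ (∀ n, 1 ≤ n → d n ≤ b n) ∧ (∀ n, d n ≤ 1) ∧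
      ∀ i j, d (i + j) ≤ d i * d j := by
  -- d n = exp (- h n), with h superadditive: take h n = n * (sum over i ≤ n of |log (b i)|)
  let h : ℕ → ℝ := fun n => ∑ i ∈ Finset.range (n + 1), |Real.log (b i)|
  have hmono : Monotone h := by
    intro m n hmn
    exact Finset.sum_le_sum_of_subset_of_nonneg (Finset.range_mono (by omega))
      (fun _ _ _ => abs_nonneg _)
  have hnn : ∀ n, 0 ≤ h n := fun n => Finset.sum_nonneg (fun _ _ => abs_nonneg _)
  refine ⟨fun n => Real.exp (-(n * h n)), by simp, fun n => Real.exp_pos _, ?_, ?_, ?_⟩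
  · intro n hn
    have h1 : |Real.log (b n)| ≤ h n :=
      Finset.single_le_sum (f := fun i => |Real.log (b i)|) (fun _ _ => abs_nonneg _)
        (Finset.mem_range.2 (Nat.lt_succ_self n))
    have h2 : (1:ℝ) ≤ n := by exact_mod_cast hn
    calc Real.exp (-(n * h n)) ≤ Real.exp (Real.log (b n)) := by
          apply Real.exp_le_exp.2
          have := neg_abs_le (Real.log (b n))
          nlinarith [hnn n]
      _ = b n := Real.exp_log (hb n)
  · intro n
    rw [Real.exp_le_one_iff]
    have := mul_nonneg (Nat.cast_nonneg (α := ℝ) n) (hnn n)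
    linarith
  · intro i j
    rw [← Real.exp_add]
    apply Real.exp_le_exp.2
    have h1 := mul_le_mul_of_nonneg_left (hmono (show i ≤ i + j by omega)) (Nat.cast_nonneg (α := ℝ) i)
    have h2 := mul_le_mul_of_nonneg_left (hmono (show j ≤ i + j by omega)) (Nat.cast_nonneg (α := ℝ) j)
    push_cast
    linarith

theorem exists_weight (a : ℤ → ℝ) (ha0 : ∀ k, 0 ≤ a k)
    (ha : ∀ m : ℕ, Summable fun k : ℤ => |(k : ℝ)| ^ m * a k) :
    ∃ W : Weight, Summable fun k => W.w k * a k := by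
  let A : ℕ → ℝ := fun m => ∑' k : ℤ, |(k : ℝ)| ^ m * a k
  have hA : ∀ m, 0 ≤ A m := fun m => tsum_nonneg fun k => by have := ha0 k; positivity
  obtain ⟨d, d0, dpos, dle, d1, dsub⟩ := exists_submul_seq (fun m => (m.factorial : ℝ) * (1/2) ^ m / (A m + 1))
    (fun n => by have := hA n; positivity)
  let c : ℕ → ℝ := fun m => d m / m.factorial
  have hc0 : ∀ m, 0 < c m := fun m => div_pos (dpos m) (by positivity)
  have hsum : ∀ x : ℝ, 0 ≤ x → Summable fun m => c m * x ^ m := by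
    intro x hx
    refine Summable.of_nonneg_of_le (fun m => mul_nonneg (hc0 m).le (pow_nonneg hx m)) ?_
      (Real.summable_pow_div_factorial x)
    intro m
    have h1 := d1 m
    have : c m ≤ 1 / m.factorial := by
      show d m / _ ≤ _
      gcongr
    calc c m * x ^ m ≤ 1 / m.factorial * x ^ m := by gcongr
      _ = _ := by ring
  let w : ℝ → ℝ := fun x => ∑' m, c m * x ^ m
  have hge : ∀ x, 0 ≤ x → ∀ m, c m * x ^ m ≤ w x := fun x hx m =>
    (hsum x hx).le_tsum m (fun j _ => mul_nonneg (hc0 j).le (pow_nonneg hx j))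
  have hmono : ∀ x y, 0 ≤ x → x ≤ y → w x ≤ w y := by
    intro x y hx hxy
    refine (hsum x hx).tsum_le_tsum (fun m => ?_) (hsum y (hx.trans hxy))
    have := (hc0 m).le
    gcongr
  have hsub : ∀ x y, 0 ≤ x → 0 ≤ y → w (x + y) ≤ w x * w y := by
    intro x y hx hy
    have hn : ∀ x, 0 ≤ x → Summable fun m => ‖c m * x ^ m‖ := by
      intro x hx
      refine (hsum x hx).congr fun m => ?_
      rw [Real.norm_of_nonneg (mul_nonneg (hc0 m).le (pow_nonneg hx m))]
    have key := tsum_mul_tsum_eq_tsum_sum_antidiagonal_of_summable_norm (hn x hx) (hn y hy)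
    have key2 := (summable_norm_sum_mul_antidiagonal_of_summable_norm (hn x hx) (hn y hy)).of_norm
    show w (x + y) ≤ (∑' m, c m * x ^ m) * (∑' m, c m * y ^ m)
    rw [key]
    refine (hsum (x+y) (by positivity)).tsum_le_tsum (fun m => ?_) key2
    rw [(Commute.all x y).add_pow', Finset.mul_sum]
    refine Finset.sum_le_sum fun p hp => ?_
    replace hp := Finset.HasAntidiagonal.mem_antidiagonal.1 hp
    have e1 : (m.choose p.1 : ℝ) / m.factorial = 1 / (p.1.factorial * p.2.factorial) := by
      subst hp
      rw [Nat.cast_choose ℝ (Nat.le_add_right _ _)]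
      have := Nat.factorial_ne_zero (p.1 + p.2)
      rw [Nat.add_sub_cancel_left]
      field_simp
    have e2 : c m * (m.choose p.1 : ℝ) ≤ c p.1 * c p.2 := by
      have : c m * (m.choose p.1 : ℝ) = d m * ((m.choose p.1 : ℝ) / m.factorial) := by
        show d m / _ * _ = _
        ring
      rw [this, e1]
      have h3 := dsub p.1 p.2
      rw [hp] at h3
      calc d m * (1 / (p.1.factorial * p.2.factorial)) ≤ (d p.1 * d p.2) * (1 / (p.1.factorial * p.2.factorial)) := by gcongr
        _ = c p.1 * c p.2 := by
          show _ = d p.1 / _ * (d p.2 / _)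
          field_simp
    calc c m * (m.choose p.1 • (x ^ p.1 * y ^ p.2)) = (c m * (m.choose p.1 : ℝ)) * (x ^ p.1 * y ^ p.2) := by
          rw [nsmul_eq_mul]; ring
      _ ≤ (c p.1 * c p.2) * (x ^ p.1 * y ^ p.2) := by gcongr
      _ = _ := by ring
  refine ⟨⟨fun k => w |(k:ℝ)|, ?_, ?_, ?_, ?_⟩, ?_⟩
  · intro k
    have := hge |(k:ℝ)| (abs_nonneg _) 0
    have h2 := hc0 0
    simp only [pow_zero, mul_one] at this
    linarith
  · intro j k
    push_cast
    exact (hmono _ _ (abs_nonneg _) (abs_add_le _ _)).trans (hsub _ _ (abs_nonneg _) (abs_nonneg _))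
  · intro k; simp
  · intro m
    refine ⟨(c m)⁻¹, (inv_pos.2 (hc0 m)).le, fun k => ?_⟩
    have := hge |(k:ℝ)| (abs_nonneg _) m
    rw [inv_mul_eq_div, le_div_iff₀ (hc0 m)]
    linarith
  · -- summability
    have hs1 : ∀ m, Summable fun k : ℤ => c m * (|(k : ℝ)| ^ m * a k) := fun m => (ha m).mul_left _
    have hb : ∀ m, 1 ≤ m → ∑' k : ℤ, c m * (|(k : ℝ)| ^ m * a k) ≤ (1/2) ^ m := by
      intro m hm
      rw [tsum_mul_left]
      have h1 := dle m hm
      have hAm := hA m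
      have hf : (0:ℝ) < m.factorial := by positivity
      have : c m ≤ (1/2)^m / (A m + 1) := by
        show d m / _ ≤ _
        rw [div_le_iff₀ hf]
        calc d m ≤ _ := h1
          _ = _ := by ring
      calc c m * A m ≤ (1/2)^m / (A m + 1) * A m := by gcongr
        _ = (1/2)^m * (A m / (A m + 1)) := by ring
        _ ≤ (1/2)^m * 1 := by
          gcongr
          rw [div_le_one (by linarith)]; linarith
        _ = _ := mul_one _
    have hsm : Summable fun m => ∑' k : ℤ, c m * (|(k : ℝ)| ^ m * a k) := by
      rw [← summable_nat_add_iff 1]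
      refine Summable.of_nonneg_of_le (fun m => tsum_nonneg fun k => ?_) (fun m => hb (m+1) (by omega))
        ((summable_nat_add_iff 1).2 (summable_geometric_of_lt_one (by norm_num : (0:ℝ) ≤ 1/2) (by norm_num)))
      have := ha0 k; have := (hc0 (m+1)).le; positivity
    have hprod : Summable fun q : ℕ × ℤ => c q.1 * (|(q.2 : ℝ)| ^ q.1 * a q.2) := by
      rw [summable_prod_of_nonneg]
      · exact ⟨hs1, hsm⟩
      · intro q
        have := ha0 q.2; have := (hc0 q.1).le
        show 0 ≤ _
        positivity
    have h3 := hprod.prod_symm.prod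
    refine h3.congr fun k => Eq.symm ?_
    show (∑' m, c m * |(k:ℝ)| ^ m) * a k = ∑' m, c m * (|(k:ℝ)| ^ m * a k)
    rw [← tsum_mul_right]
    exact tsum_congr fun m => by ring

end GP

namespace GP

/-- The exponentials `e^{iks}`. -/
def ee (k : ℤ) (s : ℝ) : ℂ := Complex.exp (Complex.I * k * s)

theorem norm_ee (k : ℤ) (s : ℝ) : ‖ee k s‖ = 1 := by
  have : Complex.I * k * s = ((k * s : ℝ) : ℂ) * Complex.I := by push_cast; ring
  rw [ee, this, Complex.norm_exp_ofReal_mul_I]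

theorem ee_add (j k : ℤ) (s : ℝ) : ee (j + k) s = ee j s * ee k s := by
  rw [ee, ee, ee, ← Complex.exp_add]; push_cast; ring_nf

theorem ee_zero (s : ℝ) : ee 0 s = 1 := by simp [ee]

theorem ee_neg (k : ℤ) (s : ℝ) : ee (-k) s = star (ee k s) := by
  rw [ee, ee, Complex.star_def, ← Complex.exp_conj]; simp

theorem continuous_ee (k : ℤ) : Continuous (ee k) := by unfold ee; fun_prop

theorem hasDerivAt_ee (k : ℤ) (s : ℝ) : HasDerivAt (ee k) (Complex.I * k * ee k s) s := by
  have h1 : HasDerivAt (fun s : ℝ => Complex.I * k * (s : ℂ)) (Complex.I * k * 1) s :=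
    (Complex.ofRealCLM.hasDerivAt (x := s)).const_mul _
  have := h1.cexp
  rw [mul_one] at this
  rw [ee, mul_comm]
  exact this

theorem ee_periodic (k : ℤ) : Function.Periodic (ee k) (2 * π) := by
  intro s
  rw [ee, ee]
  have : Complex.I * k * ((s + 2 * π : ℝ) : ℂ) = Complex.I * k * s + k * (2 * π * Complex.I) := by
    push_cast; ring
  rw [this, Complex.exp_add, Complex.exp_int_mul_two_pi_mul_I, mul_one]

theorem integral_ee (n : ℤ) : ∫ s in (0:ℝ)..(2 * π), ee n s = if n = 0 then (2 * π : ℂ) else 0 := by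
  split_ifs with h
  · subst h; simp [ee_zero]
  · have hn : (Complex.I * n : ℂ) ≠ 0 := by simp [h]
    have : ∀ s ∈ uIcc (0:ℝ) (2*π), HasDerivAt (fun s => (Complex.I * n)⁻¹ * ee n s) (ee n s) s := by
      intro s _
      have := (hasDerivAt_ee n s).const_mul (Complex.I * n : ℂ)⁻¹
      rwa [inv_mul_cancel_left₀ hn] at this
    rw [intervalIntegral.integral_eq_sub_of_hasDerivAt this ((continuous_ee n).intervalIntegrable _ _)]
    have := ee_periodic n 0
    simp only [zero_add] at this
    rw [this]; simp

theorem coeff_extract (c : ℤ → ℂ) (hc : Summable fun k => ‖c k‖) (n : ℤ) :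
    ∫ s in (0:ℝ)..(2 * π), (∑' k, c k * ee k s) * ee (-n) s = 2 * π * c n := by
  have hs : ∀ s, (∑' k, c k * ee k s) * ee (-n) s = ∑' k, c k * ee (k - n) s := by
    intro s
    rw [← tsum_mul_right]
    refine tsum_congr fun k => ?_
    rw [mul_assoc, ← ee_add, sub_eq_add_neg]
  simp_rw [hs]
  have key := intervalIntegral.hasSum_integral_of_dominated_convergence
    (μ := volume) (a := 0) (b := 2 * π) (F := fun k s => c k * ee (k - n) s) (f := fun s => ∑' k, c k * ee (k - n) s)
    (fun k _ => ‖c k‖) (fun k => ((continuous_const.mul (continuous_ee _))).aestronglyMeasurable)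
    (fun k => Eventually.of_forall fun s _ => by simp [norm_ee])
    (Eventually.of_forall fun s _ => hc)
    (intervalIntegrable_const)
    (Eventually.of_forall fun s _ => by
      refine Summable.hasSum (Summable.of_norm ?_)
      simpa [norm_ee] using hc)
  rw [← key.tsum_eq]
  rw [tsum_eq_single n]
  · rw [intervalIntegral.integral_const_mul, integral_ee]; simp [mul_comm]
  · intro k hk
    rw [intervalIntegral.integral_const_mul, integral_ee]
    simp [sub_eq_zero, hk]

/-- Continuous functions of time. -/
abbrev Bt := C(unitInterval, ℂ)

/-- Clamped time. -/
def pt (t : ℝ) : unitInterval := projIcc 0 1 zero_le_one t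

theorem continuous_pt : Continuous pt := continuous_projIcc (h := zero_le_one)

abbrev Lsp := lp (fun _ : ℤ => Bt) 1

def realSub : Submodule ℝ Lsp where
  carrier := {x | ∀ k, x (-k) = star (x k)}
  add_mem' := by
    intro a b ha hb k
    simp only [lp.coeFn_add, Pi.add_apply, star_add, ha k, hb k]
  zero_mem' := by intro k; simp
  smul_mem' := by
    intro c x hx k
    simp only [lp.coeFn_smul, Pi.smul_apply, hx k]
    ext t; simp

theorem isClosed_realSub : IsClosed (realSub : Set Lsp) := by
  have : (realSub : Set Lsp) = ⋂ k : ℤ, {x : Lsp | x (-k) = star (x k)} := by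
    ext x; rw [mem_iInter]; rfl
  rw [this]
  refine isClosed_iInter fun k => isClosed_eq ?_ ?_
  · exact (lp.lipschitzWith_one_eval 1 (-k)).continuous
  · exact continuous_star.comp (lp.lipschitzWith_one_eval 1 k).continuous

/-- The weighted Wiener algebra of real functions of space and time. -/
def WA (_ : Weight) : Type := realSub

variable {W : Weight}

instance : NormedAddCommGroup (WA W) := inferInstanceAs (NormedAddCommGroup realSub)
instance : NormedSpace ℝ (WA W) := inferInstanceAs (NormedSpace ℝ realSub)
instance : CompleteSpace (WA W) := by
  have : CompleteSpace realSub := isClosed_realSub.completeSpace_coe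
  exact this

def coef (x : WA W) (k : ℤ) : Bt := (W.w k)⁻¹ • (x.1 : Lsp) k

theorem coef_add (x y : WA W) (k : ℤ) : coef (x + y) k = coef x k + coef y k := by
  show (W.w k)⁻¹ • ((x.1 + y.1 : Lsp) k) = _
  exact smul_add (M := ℝ) (A := Bt) (W.w k)⁻¹ ((x.1 : Lsp) k) ((y.1 : Lsp) k)

theorem coef_zero (k : ℤ) : coef (0 : WA W) k = 0 := by
  show (W.w k)⁻¹ • ((0 : Lsp) k) = _
  exact smul_zero (M := ℝ) (A := Bt) (W.w k)⁻¹

theorem coef_smul (c : ℝ) (x : WA W) (k : ℤ) : coef (c • x) k = c • coef x k := by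
  show (W.w k)⁻¹ • ((c • x.1 : Lsp) k) = _
  rw [lp.coeFn_smul, Pi.smul_apply, smul_comm]; rfl

theorem hasSum_coef (x : WA W) : HasSum (fun k => W.w k * ‖coef x k‖) ‖x‖ := by
  have h := lp.hasSum_norm (p := 1) (by simp) (x.1 : Lsp)
  simp only [ENNReal.toReal_one, Real.rpow_one] at h
  have e : ∀ k, W.w k * ‖coef x k‖ = ‖(x.1 : Lsp) k‖ := by
    intro k
    rw [coef, norm_smul, norm_inv, Real.norm_of_nonneg (W.pos k).le,
      mul_inv_cancel_left₀ (W.pos k).ne']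
  simp_rw [e]
  exact h

theorem coef_neg_index (x : WA W) (k : ℤ) : coef x (-k) = star (coef x k) := by
  have h := x.2 k
  rw [coef, coef, W.symm]
  rw [show (x.1 : Lsp) (-k) = star ((x.1 : Lsp) k) from h]
  ext t; simp

theorem coef_ext {x y : WA W} (h : ∀ k, coef x k = coef y k) : x = y := by
  apply Subtype.ext
  apply lp.ext
  funext k
  have := h k
  rw [coef, coef] at this
  exact smul_right_injective _ (inv_ne_zero (W.pos k).ne') this

def mk (a : ℤ → Bt) (h : Summable fun k => W.w k * ‖a k‖) (hs : ∀ k, a (-k) = star (a k)) : WA W :=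
  ⟨⟨fun k => W.w k • a k, by
    refine memℓp_gen ?_
    simp only [ENNReal.toReal_one, Real.rpow_one]
    refine h.congr fun k => ?_
    rw [norm_smul, Real.norm_of_nonneg (W.pos k).le]⟩, by
    intro k
    show W.w (-k) • a (-k) = star (W.w k • a k)
    rw [W.symm, hs]
    ext t; simp⟩

theorem coef_mk (a : ℤ → Bt) (h : Summable fun k => W.w k * ‖a k‖) (hs : ∀ k, a (-k) = star (a k)) (k : ℤ) :
    coef (mk a h hs) k = a k := by
  show (W.w k)⁻¹ • (W.w k • a k) = _
  rw [inv_smul_smul₀ (W.pos k).ne']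

/-- polynomially weighted summability -/
theorem summable_pow_coef (x : WA W) (m : ℕ) : Summable fun k : ℤ => |(k : ℝ)| ^ m * ‖coef x k‖ := by
  obtain ⟨C, hC0, hC⟩ := W.growth m
  refine Summable.of_nonneg_of_le (fun k => by positivity) (fun k => ?_) ((hasSum_coef x).summable.mul_left C)
  rw [← mul_assoc]
  exact mul_le_mul_of_nonneg_right (hC k) (norm_nonneg _)

theorem summable_coef (x : WA W) : Summable fun k : ℤ => ‖coef x k‖ := by
  simpa using summable_pow_coef x 0

/-- Complex evaluation of the `j`-th space derivative. -/
def ev (x : WA W) (j : ℕ) (s t : ℝ) : ℂ := ∑' k : ℤ, (Complex.I * k) ^ j * coef x k (pt t) * ee k s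

theorem ev_term_norm (x : WA W) (j : ℕ) (k : ℤ) (s t : ℝ) :
    ‖(Complex.I * k) ^ j * coef x k (pt t) * ee k s‖ ≤ |(k : ℝ)| ^ j * ‖coef x k‖ := by
  rw [norm_mul, norm_ee, mul_one, norm_mul, norm_pow, norm_mul, Complex.norm_I, one_mul,
    Complex.norm_intCast]
  gcongr
  exact ContinuousMap.norm_coe_le_norm _ _

theorem summable_ev (x : WA W) (j : ℕ) (s t : ℝ) :
    Summable fun k : ℤ => (Complex.I * k) ^ j * coef x k (pt t) * ee k s :=
  Summable.of_norm_bounded (summable_pow_coef x j) fun k => ev_term_norm x j k s t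

theorem continuous_ev (x : WA W) (j : ℕ) : Continuous fun p : ℝ × ℝ => ev x j p.1 p.2 := by
  refine continuous_tsum (fun k => ?_) (summable_pow_coef x j) fun k p => ev_term_norm x j k p.1 p.2
  have h1 := (coef x k).continuous.comp (continuous_pt.comp (continuous_snd (X := ℝ) (Y := ℝ)))
  have h2 := (continuous_ee k).comp (continuous_fst (X := ℝ) (Y := ℝ))
  exact (continuous_const.mul h1).mul h2

theorem hasDerivAt_ev (x : WA W) (j : ℕ) (s t : ℝ) :
    HasDerivAt (fun s => ev x j s t) (ev x (j + 1) s t) s := by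
  have h := hasDerivAt_tsum (summable_pow_coef x (j+1))
    (g := fun k s => (Complex.I * k) ^ j * coef x k (pt t) * ee k s)
    (g' := fun k s => (Complex.I * k) ^ (j+1) * coef x k (pt t) * ee k s)
    (fun k s => by
      have := (hasDerivAt_ee k s).const_mul ((Complex.I * k) ^ j * coef x k (pt t))
      have e : (Complex.I * k) ^ (j+1) * coef x k (pt t) * ee k s =
        (Complex.I * k) ^ j * coef x k (pt t) * (Complex.I * k * ee k s) := by ring
      rw [e]; exact this)
    (fun k s => ev_term_norm x (j+1) k s t) (y₀ := 0) (summable_ev x j 0 t) s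
  exact h

theorem ev_periodic (x : WA W) (j : ℕ) (t : ℝ) : Function.Periodic (fun s => ev x j s t) (2 * π) := by
  intro s
  simp only [ev, ee_periodic _ s]

theorem ev_star (x : WA W) (j : ℕ) (s t : ℝ) : star (ev x j s t) = ev x j s t := by
  rw [ev, tsum_star]
  conv_rhs => rw [← (Equiv.neg ℤ).tsum_eq]
  refine tsum_congr fun k => ?_
  simp only [Equiv.neg_apply, coef_neg_index, ee_neg, star_mul', star_pow]
  simp

theorem ev_add (x y : WA W) (j : ℕ) (s t : ℝ) : ev (x + y) j s t = ev x j s t + ev y j s t := by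
  rw [ev, ev, ev, ← (summable_ev x j s t).tsum_add (summable_ev y j s t)]
  refine tsum_congr fun k => ?_
  rw [coef_add, ContinuousMap.add_apply]; ring

theorem ev_smul (c : ℝ) (x : WA W) (j : ℕ) (s t : ℝ) : ev (c • x) j s t = c * ev x j s t := by
  rw [ev, ev, ← tsum_mul_left]
  refine tsum_congr fun k => ?_
  rw [coef_smul, ContinuousMap.smul_apply, Complex.real_smul]; ring

theorem ev_eq (x : WA W) (s t : ℝ) : ev x 0 s t = ∑' k : ℤ, coef x k (pt t) * ee k s := by
  simp [ev]

theorem ev_coeff (x : WA W) (n : ℤ) (t : ℝ) :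
    ∫ s in (0:ℝ)..(2 * π), ev x 0 s t * ee (-n) s = 2 * π * coef x n (pt t) := by
  simp_rw [ev_eq]
  refine coeff_extract (fun k => coef x k (pt t)) ?_ n
  exact Summable.of_nonneg_of_le (fun _ => norm_nonneg _) (fun k => ContinuousMap.norm_coe_le_norm _ _)
    (summable_coef x)

theorem ev_inj {x y : WA W} (h : ∀ s t, ev x 0 s t = ev y 0 s t) : x = y := by
  refine coef_ext fun k => ?_
  ext τ
  have h1 := ev_coeff x k τ
  have h2 := ev_coeff y k τ
  simp_rw [h] at h1
  rw [h2] at h1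
  have e : pt (τ : ℝ) = τ := by simp [pt]
  rw [e] at h1
  have : (2 * π : ℂ) ≠ 0 := by simp [Real.pi_ne_zero]
  exact (mul_left_cancel₀ this h1).symm

theorem norm_ev_le (x : WA W) (s t : ℝ) : ‖ev x 0 s t‖ ≤ ∑' k, ‖coef x k‖ := by
  rw [ev_eq]
  refine tsum_of_norm_bounded (summable_coef x).hasSum fun k => ?_
  rw [norm_mul, norm_ee, mul_one]
  exact ContinuousMap.norm_coe_le_norm _ _

/-- sup norm is controlled by the norm of the algebra -/
theorem exists_norm_ev_le (W : Weight) : ∃ C : ℝ, 0 < C ∧ ∀ (x : WA W) s t, ‖ev x 0 s t‖ ≤ C * ‖x‖ := by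
  obtain ⟨C, hC0, hC⟩ := W.growth 0
  refine ⟨C + 1, by linarith, fun x s t => (norm_ev_le x s t).trans ?_⟩
  rw [← (hasSum_coef x).tsum_eq, ← tsum_mul_left]
  refine (summable_coef x).tsum_le_tsum (fun k => ?_) ((hasSum_coef x).summable.mul_left _)
  rw [← mul_assoc]
  have h1 := hC k
  rw [pow_zero] at h1
  have h2 := W.pos k
  nlinarith [norm_nonneg (coef x k)]

end GP

namespace GP
variable {W : Weight}

def shearE : ℤ × ℤ ≃ ℤ × ℤ where
  toFun q := (q.2, q.1 - q.2)
  invFun q := (q.1 + q.2, q.1)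
  left_inv q := by ext <;> simp
  right_inv q := by ext <;> simp

def wt (x : WA W) (k : ℤ) : ℝ := W.w k * ‖coef x k‖

theorem wt_nonneg (x : WA W) (k : ℤ) : 0 ≤ wt x k := mul_nonneg (W.pos k).le (norm_nonneg _)

theorem summable_wt (x y : WA W) : Summable fun q : ℤ × ℤ => wt x q.2 * wt y (q.1 - q.2) := by
  have h := (hasSum_coef x).summable.mul_of_nonneg (hasSum_coef y).summable
    (fun k => wt_nonneg x k) (fun k => wt_nonneg y k)
  exact shearE.summable_iff.2 h

theorem tsum_wt (x y : WA W) : ∑' q : ℤ × ℤ, wt x q.2 * wt y (q.1 - q.2) = ‖x‖ * ‖y‖ := by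
  have h := (hasSum_coef x).summable.mul_of_nonneg (hasSum_coef y).summable
    (fun k => wt_nonneg x k) (fun k => wt_nonneg y k)
  have h2 := (hasSum_coef x).mul (hasSum_coef y) h
  rw [← h2.tsum_eq]
  exact shearE.tsum_eq (fun q : ℤ × ℤ => wt x q.1 * wt y q.2)

theorem conv_term_le (x y : WA W) (k j : ℤ) :
    W.w k * ‖coef x j * coef y (k - j)‖ ≤ wt x j * wt y (k - j) := by
  have h1 := W.submul j (k - j)
  rw [add_sub_cancel] at h1
  calc W.w k * ‖coef x j * coef y (k - j)‖ ≤ (W.w j * W.w (k-j)) * (‖coef x j‖ * ‖coef y (k - j)‖) := by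
        have := (W.pos j).le
        have := (W.pos (k-j)).le
        have := norm_mul_le (coef x j) (coef y (k - j))
        gcongr
    _ = _ := by unfold wt; ring

theorem summable_conv_norm (x y : WA W) (k : ℤ) : Summable fun j => ‖coef x j * coef y (k - j)‖ := by
  have h := (summable_wt x y).prod_factor k
  refine Summable.of_nonneg_of_le (fun _ => norm_nonneg _) (fun j => ?_) (h.mul_left (W.w k)⁻¹)
  rw [inv_mul_eq_div, le_div_iff₀' (W.pos k)]
  exact conv_term_le x y k j

def conv (x y : WA W) (k : ℤ) : Bt := ∑' j, coef x j * coef y (k - j)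

theorem conv_norm_le (x y : WA W) (k : ℤ) : W.w k * ‖conv x y k‖ ≤ ∑' j, wt x j * wt y (k - j) := by
  have h := (summable_wt x y).prod_factor k
  calc W.w k * ‖conv x y k‖ ≤ W.w k * ∑' j, ‖coef x j * coef y (k - j)‖ := by
        gcongr
        · exact (W.pos k).le
        · exact norm_tsum_le_tsum_norm (summable_conv_norm x y k)
    _ = ∑' j, W.w k * ‖coef x j * coef y (k - j)‖ := by rw [tsum_mul_left]
    _ ≤ _ := ((summable_conv_norm x y k).mul_left _).tsum_le_tsum (conv_term_le x y k) h

theorem conv_star (x y : WA W) (k : ℤ) : conv x y (-k) = star (conv x y k) := by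
  unfold conv
  rw [tsum_star]
  rw [← (Equiv.neg ℤ).tsum_eq]
  refine tsum_congr fun j => ?_
  rw [Equiv.neg_apply, star_mul', ← coef_neg_index, ← coef_neg_index]
  congr 2; ring

instance : Mul (WA W) := ⟨fun x y => mk (conv x y)
  (Summable.of_nonneg_of_le (fun k => mul_nonneg (W.pos k).le (norm_nonneg _)) (conv_norm_le x y)
    (summable_wt x y).prod) (conv_star x y)⟩

theorem coef_mul (x y : WA W) (k : ℤ) : coef (x * y) k = conv x y k := coef_mk _ _ _ k

theorem norm_mul_le' (x y : WA W) : ‖x * y‖ ≤ ‖x‖ * ‖y‖ := by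
  rw [← tsum_wt, (summable_wt x y).tsum_prod, ← (hasSum_coef (x * y)).tsum_eq]
  refine (hasSum_coef (x * y)).summable.tsum_le_tsum (fun k => ?_) (summable_wt x y).prod
  rw [coef_mul]
  exact conv_norm_le x y k

theorem ev_mul (x y : WA W) (s t : ℝ) : ev (x * y) 0 s t = ev x 0 s t * ev y 0 s t := by
  have hx := summable_ev x 0 s t
  have hy := summable_ev y 0 s t
  simp only [pow_zero, one_mul] at hx hy
  rw [ev_eq, ev_eq, ev_eq]
  have hxn := hx.norm
  have hyn := hy.norm
  rw [tsum_mul_tsum_of_summable_norm hxn hyn]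
  have hs := summable_mul_of_summable_norm hxn hyn
  rw [← shearE.tsum_eq]
  have hs2 := shearE.summable_iff.2 hs
  refine Eq.trans ?_ (Summable.tsum_prod hs2).symm
  refine tsum_congr fun k => ?_
  rw [coef_mul, conv, ← ContinuousMap.tsum_apply (summable_conv_norm x y k).of_norm, ← tsum_mul_right]
  refine tsum_congr fun j => ?_
  show (coef x j * coef y (k - j)) (pt t) * ee k s = coef x j (pt t) * ee j s * (coef y (k - j) (pt t) * ee (k - j) s)
  have : ee k s = ee j s * ee (k - j) s := by rw [← ee_add, add_sub_cancel]
  rw [this, ContinuousMap.mul_apply]; ring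

/-- constant-mode embedding of a real-valued time function -/
def modeZero (b : Bt) (hb : star b = b) : WA W :=
  mk (fun k => if k = 0 then b else 0) (by
    refine summable_of_hasFiniteSupport ?_
    refine (Set.finite_singleton (0:ℤ)).subset fun k hk => ?_
    by_contra h
    simp only [mem_singleton_iff] at h
    simp [h] at hk) (by
    intro k
    by_cases h : k = 0 <;> simp [h, hb])

theorem coef_modeZero (b : Bt) (hb : star b = b) (k : ℤ) :
    coef (modeZero b hb : WA W) k = if k = 0 then b else 0 := coef_mk _ _ _ k

theorem ev_modeZero (b : Bt) (hb : star b = b) (s t : ℝ) : ev (modeZero b hb : WA W) 0 s t = b (pt t) := by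
  rw [ev_eq, tsum_eq_single 0]
  · simp [coef_modeZero, ee_zero]
  · intro k hk; simp [coef_modeZero, hk]

theorem norm_modeZero (b : Bt) (hb : star b = b) : ‖(modeZero b hb : WA W)‖ = W.w 0 * ‖b‖ := by
  rw [← (hasSum_coef (modeZero b hb : WA W)).tsum_eq, tsum_eq_single 0]
  · simp [coef_modeZero]
  · intro k hk; simp [coef_modeZero, hk]

instance : One (WA W) := ⟨modeZero 1 (by simp)⟩

theorem ev_one (s t : ℝ) : ev (1 : WA W) 0 s t = 1 := by
  show ev (modeZero 1 _ : WA W) 0 s t = 1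
  rw [ev_modeZero]; rfl

theorem ev_zero' (j : ℕ) (s t : ℝ) : ev (0 : WA W) j s t = 0 := by
  simp [ev, coef_zero]

instance : CommRing (WA W) :=
  { (inferInstance : AddCommGroup (WA W)) with
    mul := (· * ·)
    one := 1
    left_distrib := fun a b c => ev_inj fun s t => by simp only [ev_mul, ev_add]; ring
    right_distrib := fun a b c => ev_inj fun s t => by simp only [ev_mul, ev_add]; ring
    zero_mul := fun a => ev_inj fun s t => by simp only [ev_mul, ev_zero']; ring
    mul_zero := fun a => ev_inj fun s t => by simp only [ev_mul, ev_zero']; ring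
    mul_assoc := fun a b c => ev_inj fun s t => by simp only [ev_mul]; ring
    one_mul := fun a => ev_inj fun s t => by simp only [ev_mul, ev_one]; ring
    mul_one := fun a => ev_inj fun s t => by simp only [ev_mul, ev_one]; ring
    mul_comm := fun a b => ev_inj fun s t => by simp only [ev_mul]; ring }

instance : NormedCommRing (WA W) :=
  { (inferInstance : CommRing (WA W)), (inferInstance : NormedAddCommGroup (WA W)) with
    norm_mul_le := norm_mul_le' }

instance : Algebra ℝ (WA W) := Algebra.ofModule
  (fun r x y => ev_inj fun s t => by simp only [ev_mul, ev_smul]; ring)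
  (fun r x y => ev_inj fun s t => by simp only [ev_mul, ev_smul]; ring)

instance : NormedAlgebra ℝ (WA W) :=
  { (inferInstance : Algebra ℝ (WA W)) with
    norm_smul_le := fun r x => (norm_smul_le r x) }

/-- Real evaluation. -/
def Ev (x : WA W) (j : ℕ) (s t : ℝ) : ℝ := (ev x j s t).re

theorem coe_Ev (x : WA W) (j : ℕ) (s t : ℝ) : ((Ev x j s t : ℝ) : ℂ) = ev x j s t := by
  have := ev_star x j s t
  exact Complex.conj_eq_iff_re.1 this

theorem Ev_of {x : WA W} {j : ℕ} {s t : ℝ} {r : ℝ} (h : ev x j s t = r) : Ev x j s t = r := by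
  rw [Ev, h, Complex.ofReal_re]

theorem Ev_add (x y : WA W) (j : ℕ) (s t : ℝ) : Ev (x + y) j s t = Ev x j s t + Ev y j s t :=
  Ev_of (by rw [ev_add, ← coe_Ev, ← coe_Ev]; push_cast; rfl)
theorem Ev_smul (c : ℝ) (x : WA W) (j : ℕ) (s t : ℝ) : Ev (c • x) j s t = c * Ev x j s t :=
  Ev_of (by rw [ev_smul, ← coe_Ev]; push_cast; rfl)
theorem Ev_neg (x : WA W) (j : ℕ) (s t : ℝ) : Ev (-x) j s t = - Ev x j s t := by
  have h := Ev_smul (-1) x j s t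
  rw [neg_one_smul] at h; linarith
theorem Ev_sub (x y : WA W) (j : ℕ) (s t : ℝ) : Ev (x - y) j s t = Ev x j s t - Ev y j s t := by
  rw [sub_eq_add_neg, Ev_add, Ev_neg]; ring
theorem Ev_mul (x y : WA W) (s t : ℝ) : Ev (x * y) 0 s t = Ev x 0 s t * Ev y 0 s t :=
  Ev_of (by rw [ev_mul, ← coe_Ev, ← coe_Ev]; push_cast; rfl)
theorem Ev_one (s t : ℝ) : Ev (1 : WA W) 0 s t = 1 := Ev_of (by rw [ev_one]; simp)
theorem Ev_pow (x : WA W) (n : ℕ) (s t : ℝ) : Ev (x ^ n) 0 s t = Ev x 0 s t ^ n := by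
  induction n with
  | zero => simp [Ev_one]
  | succ n ih => rw [pow_succ, Ev_mul, ih, pow_succ]
theorem Ev_inj {x y : WA W} (h : ∀ s t, Ev x 0 s t = Ev y 0 s t) : x = y :=
  ev_inj fun s t => by rw [← coe_Ev, ← coe_Ev, h]
theorem continuous_Ev (x : WA W) (j : ℕ) : Continuous fun p : ℝ × ℝ => Ev x j p.1 p.2 :=
  Complex.continuous_re.comp (continuous_ev x j)
theorem hasDerivAt_Ev (x : WA W) (j : ℕ) (s t : ℝ) :
    HasDerivAt (fun s => Ev x j s t) (Ev x (j + 1) s t) s := by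
  have := Complex.reCLM.hasFDerivAt.comp_hasDerivAt s (hasDerivAt_ev x j s t)
  exact this
theorem Ev_periodic (x : WA W) (j : ℕ) (t : ℝ) : Function.Periodic (fun s => Ev x j s t) (2 * π) := by
  intro s
  have := ev_periodic x j t s
  simp only [Ev] at this ⊢
  rw [this]
theorem exists_abs_Ev_le (W : Weight) : ∃ C : ℝ, 0 < C ∧ ∀ (x : WA W) s t, |Ev x 0 s t| ≤ C * ‖x‖ := by
  obtain ⟨C, h0, h⟩ := exists_norm_ev_le W
  exact ⟨C, h0, fun x s t => (Complex.abs_re_le_norm _).trans (h x s t)⟩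

theorem star_coef_zero (x : WA W) : star (coef x 0) = coef x 0 := by
  rw [← coef_neg_index, neg_zero]

def mean0 (x : WA W) : WA W := modeZero (coef x 0) (star_coef_zero x)

theorem coef_mean0 (x : WA W) (k : ℤ) : coef (mean0 x) k = if k = 0 then coef x 0 else 0 :=
  coef_modeZero _ _ _

/-- The mean-value operator in space. -/
def Mean : WA W →L[ℝ] WA W :=
  LinearMap.mkContinuous
    { toFun := mean0
      map_add' := fun x y => coef_ext fun k => by
        rw [coef_add, coef_mean0, coef_mean0, coef_mean0]
        split_ifs
        · rw [coef_add]
        · simp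
      map_smul' := fun c x => coef_ext fun k => by
        rw [RingHom.id_apply, coef_smul, coef_mean0, coef_mean0]
        split_ifs
        · rw [coef_smul]
        · exact (smul_zero (A := Bt) c).symm } 1 (fun x => by
        rw [LinearMap.coe_mk, AddHom.coe_mk, mean0, norm_modeZero, one_mul]
        exact le_hasSum (hasSum_coef x) 0 (fun k _ => mul_nonneg (W.pos k).le (norm_nonneg _)))

theorem Ev_Mean (x : WA W) (s t : ℝ) :
    Ev (Mean x) 0 s t = (2 * π)⁻¹ * ∫ s' in (0:ℝ)..(2 * π), Ev x 0 s' t := by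
  apply Ev_of
  have h := ev_coeff x 0 t
  simp only [neg_zero, ee_zero, mul_one] at h
  show ev (modeZero (coef x 0) (star_coef_zero x) : WA W) 0 s t = _
  rw [ev_modeZero]
  have h2 : ∫ s in (0:ℝ)..(2 * π), ev x 0 s t = ∫ s in (0:ℝ)..(2 * π), ((Ev x 0 s t : ℝ) : ℂ) :=
    intervalIntegral.integral_congr fun s _ => (coe_Ev x 0 s t).symm
  rw [h2, intervalIntegral.integral_ofReal] at h
  push_cast
  rw [h]
  have : (2 * π : ℂ) ≠ 0 := by simp [Real.pi_ne_zero]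
  field_simp

end GP

namespace GP
variable {W : Weight}

/-- smooth `2π`-periodic real functions -/
def SP (g : ℝ → ℝ) : Prop := ContDiff ℝ (⊤ : ℕ∞) g ∧ Function.Periodic g (2 * π)

theorem SP.differentiable {g : ℝ → ℝ} (h : SP g) : Differentiable ℝ g := h.1.differentiable (by simp)

theorem SP.deriv {g : ℝ → ℝ} (h : SP g) : SP (deriv g) := by
  refine ⟨?_, fun x => ?_⟩
  · exact ((contDiff_infty_iff_deriv (𝕜 := ℝ)).1 h.1).2
  · have : (fun y => g (y + 2 * π)) = g := funext h.2
    rw [← deriv_comp_add_const, this]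

def fc (g : ℝ → ℝ) (k : ℤ) : ℂ := (2 * π : ℂ)⁻¹ * ∫ s in (0:ℝ)..(2 * π), (g s : ℂ) * ee (-k) s

theorem fc_deriv {g : ℝ → ℝ} (h : SP g) (k : ℤ) : fc (deriv g) k = Complex.I * k * fc g k := by
  have h1 := intervalIntegral.integral_mul_deriv_eq_deriv_mul (a := 0) (b := 2 * π)
    (u := fun s => ee (-k) s) (v := fun s => (g s : ℂ)) (u' := fun s => Complex.I * (-k : ℤ) * ee (-k) s)
    (v' := fun s => ((deriv g s : ℝ) : ℂ)) (fun s _ => hasDerivAt_ee (-k) s)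
    (fun s _ => (h.differentiable s).hasDerivAt.ofReal_comp)
    ((continuous_const.mul (continuous_ee _)).intervalIntegrable _ _)
    ((Complex.continuous_ofReal.comp h.deriv.1.continuous).intervalIntegrable _ _)
  have e1 := ee_periodic (-k) 0
  have e2 := h.2 0
  rw [zero_add] at e1 e2
  rw [e1, e2, sub_self, zero_sub] at h1
  rw [fc, fc]
  simp_rw [mul_comm _ (ee (-k) _)]
  rw [h1]
  simp_rw [mul_assoc]
  rw [intervalIntegral.integral_const_mul, intervalIntegral.integral_const_mul]
  push_cast; ring

theorem norm_fc_le {g : ℝ → ℝ} (h : SP g) : ∃ C, 0 ≤ C ∧ ∀ k, ‖fc g k‖ ≤ C := by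
  refine ⟨‖(2 * π : ℂ)⁻¹‖ * |∫ s in (0:ℝ)..(2 * π), ‖g s‖|, by positivity, fun k => ?_⟩
  rw [fc, norm_mul]
  gcongr
  refine (intervalIntegral.norm_integral_le_abs_integral_norm).trans (le_of_eq ?_)
  simp [norm_ee]

theorem fc_decay (m : ℕ) : ∀ {g : ℝ → ℝ}, SP g → ∃ C, 0 ≤ C ∧ ∀ k : ℤ, |(k:ℝ)| ^ m * ‖fc g k‖ ≤ C := by
  induction m with
  | zero => intro g h; simpa using norm_fc_le h
  | succ m ih =>
    intro g h
    obtain ⟨C, h0, hC⟩ := ih h.deriv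
    refine ⟨C, h0, fun k => ?_⟩
    have := hC k
    rw [fc_deriv h, norm_mul, norm_mul, Complex.norm_I, Complex.norm_intCast] at this
    calc _ = _ := by ring
      _ ≤ _ := this

theorem summable_fc {g : ℝ → ℝ} (h : SP g) (m : ℕ) : Summable fun k : ℤ => |(k:ℝ)| ^ m * ‖fc g k‖ := by
  obtain ⟨C, h0, hC⟩ := fc_decay (m + 2) h
  obtain ⟨C', h0', hC'⟩ := fc_decay m h
  have hs : Summable fun k : ℤ => C * (1 / (k:ℝ) ^ 2) + (if k = 0 then C' else 0) := by
    refine ((Real.summable_one_div_int_pow.2 one_lt_two).mul_left C).add ?_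
    exact (hasSum_ite_eq (0:ℤ) C').summable
  refine Summable.of_nonneg_of_le (fun k => by positivity) (fun k => ?_) hs
  by_cases hk : k = 0
  · have := hC' k
    simpa [hk] using this
  · rw [if_neg hk, add_zero, mul_one_div, le_div_iff₀ (by positivity), ← sq_abs (k:ℝ)]
    calc _ = _ := by ring
      _ ≤ _ := hC k

theorem fc_star (g : ℝ → ℝ) (k : ℤ) : fc g (-k) = star (fc g k) := by
  rw [fc, fc, star_mul', Complex.star_def, intervalIntegral.integral_of_le Real.two_pi_pos.le,
    intervalIntegral.integral_of_le Real.two_pi_pos.le, ← integral_conj]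
  congr 1
  · have : ((2 * π : ℂ)⁻¹) = (((2 * π)⁻¹ : ℝ) : ℂ) := by push_cast; rfl
    rw [this, Complex.conj_ofReal]
  · refine integral_congr_ae (Eventually.of_forall fun s => ?_)
    simp only [map_mul, Complex.conj_ofReal]
    rw [ee_neg (-k)]; rfl

theorem hasSum_fc {g : ℝ → ℝ} (h : SP g) (s : ℝ) : HasSum (fun k => fc g k * ee k s) (g s : ℂ) := by
  have : Fact (0 < 2 * π) := ⟨Real.two_pi_pos⟩
  have hp : Function.Periodic (fun s => (g s : ℂ)) (2 * π) := fun s => by simp only [h.2 s]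
  have hc : Continuous (hp.lift : AddCircle (2 * π) → ℂ) :=
    continuous_coinduced_dom.2 (Complex.continuous_ofReal.comp h.1.continuous)
  let f : C(AddCircle (2 * π), ℂ) := ⟨hp.lift, hc⟩
  have he : ∀ (k : ℤ) (x : ℝ), fourier k (x : AddCircle (2 * π)) = ee k x := by
    intro k x
    rw [fourier_coe_apply, ee]
    congr 1
    have : (π : ℂ) ≠ 0 := by simp [Real.pi_ne_zero]
    push_cast; field_simp
  have hf : ∀ k, fourierCoeff f k = fc g k := by
    intro k
    rw [fourierCoeff_eq_intervalIntegral f k 0, fc, zero_add, Complex.real_smul]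
    congr 1
    · simp
    · refine intervalIntegral.integral_congr fun s _ => ?_
      show fourier (-k) (s : AddCircle (2 * π)) • hp.lift (s : AddCircle (2 * π)) = _
      rw [he, Function.Periodic.lift_coe, smul_eq_mul, mul_comm]
  have hsum : Summable (fourierCoeff f) := by
    refine Summable.of_norm ?_
    simp_rw [hf]
    simpa using summable_fc h 0
  have := has_pointwise_sum_fourier_series_of_summable hsum (s : AddCircle (2 * π))
  simp_rw [hf, he, smul_eq_mul] at this
  exact this

/-- Static elements. -/
theorem exists_embed {ι : Type} [Fintype ι] (g : ι → ℝ → ℝ) (hg : ∀ i, SP (g i)) :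
    ∃ (W : Weight) (x : ι → WA W), ∀ i s t, Ev (x i) 0 s t = g i s := by
  obtain ⟨W, hW⟩ := exists_weight (fun k => ∑ i, ‖fc (g i) k‖) (fun k => Finset.sum_nonneg fun _ _ => norm_nonneg _)
    (fun m => by
      simp_rw [Finset.mul_sum]
      exact summable_sum fun i _ => summable_fc (hg i) m)
  refine ⟨W, fun i => mk (fun k => ContinuousMap.const _ (fc (g i) k)) ?_ ?_, ?_⟩
  · refine Summable.of_nonneg_of_le (fun k => mul_nonneg (W.pos k).le (norm_nonneg _)) (fun k => ?_) hW
    refine mul_le_mul_of_nonneg_left ?_ (W.pos k).le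
    refine ((ContinuousMap.norm_le _ (norm_nonneg (fc (g i) k))).2 fun _ => le_rfl).trans ?_
    exact Finset.single_le_sum (f := fun i => ‖fc (g i) k‖) (fun _ _ => norm_nonneg _) (Finset.mem_univ i)
  · intro k; ext t; simp [fc_star]
  · intro i s t
    apply Ev_of
    rw [ev_eq, ← (hasSum_fc (hg i) s).tsum_eq]
    refine tsum_congr fun k => ?_
    rw [coef_mk]; rfl

end GP

namespace GP
variable {W : Weight}

/-- Duhamel integral with decay rate `l`. -/
def U (l : ℝ) (f : Bt) (t : ℝ) : ℂ :=
  ((rexp (-(l * t)) : ℝ) : ℂ) * ∫ τ in (0:ℝ)..t, ((rexp (l * τ) : ℝ) : ℂ) * f (pt τ)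

theorem continuous_U_aux (l : ℝ) (f : Bt) : Continuous fun τ : ℝ => ((rexp (l * τ) : ℝ) : ℂ) * f (pt τ) := by
  have h1 : Continuous fun τ : ℝ => f (pt τ) := f.continuous.comp continuous_pt
  exact Continuous.mul (by fun_prop) h1

theorem hasDerivAt_U (l : ℝ) (f : Bt) (t : ℝ) : HasDerivAt (U l f) (f (pt t) - l * U l f t) t := by
  have h1 : HasDerivAt (fun t : ℝ => ((rexp (-(l * t)) : ℝ) : ℂ)) ((rexp (-(l * t)) * (-(l * 1)) : ℝ) : ℂ) t := by
    have : HasDerivAt (fun t : ℝ => rexp (-(l * t))) (rexp (-(l * t)) * (-(l * 1))) t :=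
      (((hasDerivAt_id t).const_mul l).neg).exp
    exact this.ofReal_comp
  have h2 := (continuous_U_aux l f).integral_hasStrictDerivAt 0 t |>.hasDerivAt
  have h3 := h1.mul h2
  have e : f (pt t) - l * U l f t = ((rexp (-(l * t)) * (-(l * 1)) : ℝ) : ℂ) * (∫ τ in (0:ℝ)..t, ((rexp (l * τ) : ℝ) : ℂ) * f (pt τ))
     + ((rexp (-(l * t)) : ℝ) : ℂ) * (((rexp (l * t) : ℝ) : ℂ) * f (pt t)) := by
    have : ((rexp (-(l * t)) : ℝ) : ℂ) * ((rexp (l * t) : ℝ) : ℂ) = 1 := by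
      rw [← Complex.ofReal_mul, ← Real.exp_add, neg_add_cancel, Real.exp_zero, Complex.ofReal_one]
    rw [← mul_assoc, this, U]; push_cast; ring
  rw [e]
  exact h3

theorem continuous_U (l : ℝ) (f : Bt) : Continuous (U l f) :=
  continuous_iff_continuousAt.2 fun t => (hasDerivAt_U l f t).continuousAt

theorem U_zero (l : ℝ) (f : Bt) : U l f 0 = 0 := by simp [U]

theorem U_integral (l : ℝ) (f : Bt) (t : ℝ) : ∫ τ in (0:ℝ)..t, (f (pt τ) - l * U l f τ) = U l f t := by
  rw [intervalIntegral.integral_eq_sub_of_hasDerivAt (fun τ _ => hasDerivAt_U l f τ), U_zero, sub_zero]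
  have h1 : Continuous fun τ : ℝ => f (pt τ) := f.continuous.comp continuous_pt
  have := continuous_U l f
  exact Continuous.intervalIntegrable (h1.sub (continuous_const.mul this)) _ _

theorem norm_U_le_aux {l t : ℝ} (f : Bt) (ht : 0 ≤ t) :
    ‖U l f t‖ ≤ ‖f‖ * (rexp (-(l * t)) * ∫ τ in (0:ℝ)..t, rexp (l * τ)) := by
  rw [U, norm_mul, Complex.norm_real, Real.norm_of_nonneg (Real.exp_pos _).le]
  have : ‖∫ τ in (0:ℝ)..t, ((rexp (l * τ) : ℝ) : ℂ) * f (pt τ)‖ ≤ ∫ τ in (0:ℝ)..t, rexp (l * τ) * ‖f‖ := by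
    refine intervalIntegral.norm_integral_le_of_norm_le ht (Eventually.of_forall fun τ _ => ?_) ?_
    · rw [norm_mul, Complex.norm_real, Real.norm_of_nonneg (Real.exp_pos _).le]
      gcongr
      exact ContinuousMap.norm_coe_le_norm _ _
    · exact Continuous.intervalIntegrable (by fun_prop) _ _
  rw [intervalIntegral.integral_mul_const] at this
  calc _ ≤ rexp (-(l * t)) * ((∫ τ in (0:ℝ)..t, rexp (l * τ)) * ‖f‖) := by gcongr
    _ = _ := by ring

theorem norm_U_le {l t : ℝ} (f : Bt) (hl : 0 ≤ l) (ht : t ∈ Icc (0:ℝ) 1) : ‖U l f t‖ ≤ ‖f‖ := by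
  refine (norm_U_le_aux f ht.1).trans (mul_le_of_le_one_right (norm_nonneg _) ?_)
  have : ∫ τ in (0:ℝ)..t, rexp (l * τ) ≤ ∫ τ in (0:ℝ)..t, rexp (l * t) := by
    refine intervalIntegral.integral_mono_on ht.1 (Continuous.intervalIntegrable (by fun_prop) _ _)
      (Continuous.intervalIntegrable (by fun_prop) _ _) fun τ hτ => ?_
    exact Real.exp_le_exp.2 (mul_le_mul_of_nonneg_left hτ.2 hl)
  rw [intervalIntegral.integral_const, sub_zero, smul_eq_mul] at this
  calc _ ≤ rexp (-(l * t)) * (t * rexp (l * t)) := by gcongr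
    _ = t * (rexp (-(l * t)) * rexp (l * t)) := by ring
    _ = t := by rw [← Real.exp_add, neg_add_cancel, Real.exp_zero, mul_one]
    _ ≤ 1 := ht.2

theorem mul_norm_U_le {l t : ℝ} (f : Bt) (hl : 0 ≤ l) (ht : t ∈ Icc (0:ℝ) 1) : l * ‖U l f t‖ ≤ ‖f‖ := by
  have h := mul_le_mul_of_nonneg_left (norm_U_le_aux (l := l) f ht.1) hl
  refine h.trans ?_
  have e : ∫ τ in (0:ℝ)..t, l * rexp (l * τ) = rexp (l * t) - 1 := by
    rw [intervalIntegral.integral_eq_sub_of_hasDerivAt (f := fun τ => rexp (l * τ))]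
    · simp
    · intro τ _
      have := ((hasDerivAt_id τ).const_mul l).exp
      simp only [id, mul_one] at this
      rw [mul_comm]; exact this
    · exact Continuous.intervalIntegrable (by fun_prop) _ _
  rw [intervalIntegral.integral_const_mul] at e
  calc _ = ‖f‖ * (rexp (-(l * t)) * (l * ∫ τ in (0:ℝ)..t, rexp (l * τ))) := by ring
    _ = ‖f‖ * (rexp (-(l * t)) * rexp (l * t) - rexp (-(l * t))) := by rw [e]; ring
    _ = ‖f‖ * (1 - rexp (-(l * t))) := by rw [← Real.exp_add, neg_add_cancel, Real.exp_zero]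
    _ ≤ ‖f‖ := mul_le_of_le_one_right (norm_nonneg _) (by linarith [Real.exp_pos (-(l * t))])

def UB (l : ℝ) (f : Bt) : Bt := ⟨fun t => U l f t, (continuous_U l f).comp continuous_subtype_val⟩

theorem UB_pt (l : ℝ) (f : Bt) {t : ℝ} (ht : t ∈ Icc (0:ℝ) 1) : UB l f (pt t) = U l f t := by
  show U l f (pt t) = _
  rw [pt, projIcc_of_mem _ ht]

theorem UB_add (l : ℝ) (f g : Bt) : UB l (f + g) = UB l f + UB l g := by
  ext t
  show U l (f + g) t = U l f t + U l g t
  rw [U, U, U, ← mul_add, ← intervalIntegral.integral_add ((continuous_U_aux l f).intervalIntegrable _ _)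
    ((continuous_U_aux l g).intervalIntegrable _ _)]
  simp only [ContinuousMap.add_apply, mul_add]

theorem UB_smul (l : ℝ) (c : ℝ) (f : Bt) : UB l (c • f) = c • UB l f := by
  ext t
  show U l (c • f) t = c • U l f t
  rw [U, U, Complex.real_smul]
  simp only [ContinuousMap.smul_apply, Complex.real_smul]
  simp_rw [mul_left_comm _ (c : ℂ)]
  rw [intervalIntegral.integral_const_mul]; ring

theorem UB_star (l : ℝ) (f : Bt) : UB l (star f) = star (UB l f) := by
  ext t
  show U l (star f) t = star (U l f t)
  rw [U, U, star_mul', Complex.star_def, Complex.conj_ofReal, intervalIntegral.integral_of_le t.2.1,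
    intervalIntegral.integral_of_le t.2.1, ← integral_conj]
  congr 1
  refine integral_congr_ae (Eventually.of_forall fun s => ?_)
  simp only [map_mul, Complex.conj_ofReal]
  rfl

theorem norm_UB_le {l : ℝ} (f : Bt) (hl : 0 ≤ l) : ‖UB l f‖ ≤ ‖f‖ :=
  (ContinuousMap.norm_le _ (norm_nonneg _)).2 fun t => norm_U_le f hl t.2

theorem mul_norm_UB_le {l : ℝ} (f : Bt) (hl : 0 ≤ l) : l * ‖UB l f‖ ≤ ‖f‖ := by
  rcases hl.eq_or_lt with h | h
  · rw [← h, zero_mul]; exact norm_nonneg _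
  · rw [← le_div_iff₀' h]
    refine (ContinuousMap.norm_le _ (by positivity)).2 fun t => ?_
    rw [le_div_iff₀' h]
    exact mul_norm_U_le f hl t.2

/-- Fourier multiplier of the `j`-th derivative of the Duhamel operator. -/
def Mk (c ε : ℝ) (j : ℕ) (k : ℤ) (f : Bt) : Bt := ((Complex.I * k) ^ j * ε) • UB (c * ε * (k:ℝ) ^ 2) f

def Kb (c ε : ℝ) (j : ℕ) : ℝ := if j = 0 then ε else if j = 1 then √(ε / c) else 1 / c

theorem norm_Mk (c ε : ℝ) (hε : 0 < ε) (j : ℕ) (k : ℤ) (f : Bt) :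
    ‖Mk c ε j k f‖ = |(k:ℝ)| ^ j * ε * ‖UB (c * ε * (k:ℝ) ^ 2) f‖ := by
  rw [Mk, norm_smul, norm_mul, norm_pow, norm_mul, Complex.norm_I, one_mul, Complex.norm_intCast,
    Complex.norm_real, Real.norm_of_nonneg hε.le]

theorem norm_Mk_le {c ε : ℝ} (hc : 0 < c) (hε : 0 < ε) (j : ℕ) (hj : j ≤ 2) (k : ℤ) (f : Bt) :
    ‖Mk c ε j k f‖ ≤ Kb c ε j * ‖f‖ := by
  rw [norm_Mk c ε hε]
  have hl : 0 ≤ c * ε * (k:ℝ) ^ 2 := by positivity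
  have h1 := norm_UB_le f hl
  have h2 := mul_norm_UB_le f hl
  have h0 := norm_nonneg (UB (c * ε * (k:ℝ) ^ 2) f)
  have hf := norm_nonneg f
  generalize ‖UB (c * ε * (k:ℝ) ^ 2) f‖ = u at *
  have hk := sq_abs (k:ℝ)
  rw [← hk] at h2
  interval_cases j
  · simp [Kb]; gcongr
  · simp only [Kb, pow_one, one_ne_zero, if_false, if_true]
    rw [← Real.sqrt_sq hf, ← Real.sqrt_mul (by positivity)]
    refine Real.le_sqrt_of_sq_le ?_
    rw [div_mul_eq_mul_div, le_div_iff₀ hc]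
    have : (c * ε * |(k:ℝ)| ^ 2 * u) * u ≤ ‖f‖ * ‖f‖ := mul_le_mul h2 h1 h0 hf
    nlinarith
  · simp [Kb]
    rw [inv_mul_eq_div, le_div_iff₀ hc]
    rw [← hk]
    linarith

theorem Kb_nonneg {c ε : ℝ} (hc : 0 < c) (hε : 0 < ε) (j : ℕ) : 0 ≤ Kb c ε j := by
  unfold Kb; split_ifs <;> positivity

theorem Mk_star (c ε : ℝ) (j : ℕ) (k : ℤ) (f : Bt) : Mk c ε j (-k) (star f) = star (Mk c ε j k f) := by
  rw [Mk, Mk]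
  push_cast
  rw [neg_sq, UB_star]
  ext t
  simp

def K0 (c ε : ℝ) (j : ℕ) (hc : 0 < c) (hε : 0 < ε) (hj : j ≤ 2) (x : WA W) : WA W :=
  mk (fun k => Mk c ε j k (coef x k)) (by
    refine Summable.of_nonneg_of_le (fun k => mul_nonneg (W.pos k).le (norm_nonneg _)) (fun k => ?_)
      ((hasSum_coef x).summable.mul_left (Kb c ε j))
    calc _ ≤ W.w k * (Kb c ε j * ‖coef x k‖) :=
          mul_le_mul_of_nonneg_left (norm_Mk_le hc hε j hj k _) (W.pos k).le
      _ = _ := by ring) (fun k => by rw [coef_neg_index, Mk_star])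

theorem coef_K0 (c ε : ℝ) (j : ℕ) (hc : 0 < c) (hε : 0 < ε) (hj : j ≤ 2) (x : WA W) (k : ℤ) :
    coef (K0 c ε j hc hε hj x) k = Mk c ε j k (coef x k) := coef_mk _ _ _ _

/-- Duhamel operator and its first two derivatives. -/
def KK (c ε : ℝ) (j : ℕ) (hc : 0 < c) (hε : 0 < ε) (hj : j ≤ 2) : WA W →L[ℝ] WA W :=
  LinearMap.mkContinuous
    { toFun := K0 c ε j hc hε hj
      map_add' := fun x y => coef_ext fun k => by
        rw [coef_add, coef_K0, coef_K0, coef_K0, coef_add, Mk, Mk, Mk, UB_add]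
        exact smul_add (M := ℂ) (A := Bt) _ _ _
      map_smul' := fun a x => coef_ext fun k => by
        rw [RingHom.id_apply, coef_smul, coef_K0, coef_K0, coef_smul, Mk, Mk, UB_smul]
        exact smul_comm (M := ℂ) (N := ℝ) (α := Bt) _ _ _ }
    (Kb c ε j) (fun x => by
      rw [LinearMap.coe_mk, AddHom.coe_mk]
      refine hasSum_le (fun k => ?_) (hasSum_coef _) ((hasSum_coef x).mul_left (Kb c ε j))
      rw [coef_K0]
      calc _ ≤ W.w k * (Kb c ε j * ‖coef x k‖) :=
            mul_le_mul_of_nonneg_left (norm_Mk_le hc hε j hj k _) (W.pos k).le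
        _ = _ := by ring)

theorem coef_KK (c ε : ℝ) (j : ℕ) (hc : 0 < c) (hε : 0 < ε) (hj : j ≤ 2) (x : WA W) (k : ℤ) :
    coef (KK c ε j hc hε hj x) k = Mk c ε j k (coef x k) := coef_K0 c ε j hc hε hj x k

theorem norm_KK_le (c ε : ℝ) (j : ℕ) (hc : 0 < c) (hε : 0 < ε) (hj : j ≤ 2) (x : WA W) :
    ‖KK c ε j hc hε hj x‖ ≤ Kb c ε j * ‖x‖ :=
  (ContinuousLinearMap.le_opNorm _ x).trans
    (mul_le_mul_of_nonneg_right (LinearMap.mkContinuous_norm_le _ (Kb_nonneg hc hε j) _) (norm_nonneg _))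

theorem Ev_KK (c ε : ℝ) (j : ℕ) (hc : 0 < c) (hε : 0 < ε) (hj : j ≤ 2) (x : WA W) (i : ℕ) (s t : ℝ) :
    Ev (KK c ε j hc hε hj x) i s t = Ev (KK c ε 0 hc hε (by norm_num) x) (j + i) s t := by
  rw [Ev, Ev, ev, ev]
  congr 1
  refine tsum_congr fun k => ?_
  rw [coef_KK, coef_KK, Mk, Mk]
  simp only [ContinuousMap.smul_apply, smul_eq_mul]
  ring

theorem Ev_KK_integral (c ε : ℝ) (hc : 0 < c) (hε : 0 < ε) (x : WA W) (j : ℕ) (s t : ℝ)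
    (ht : t ∈ Icc (0:ℝ) 1) :
    Ev (KK c ε 0 hc hε (by norm_num) x) j s t =
      ∫ τ in (0:ℝ)..t, ε * (Ev x j s τ + c * Ev (KK c ε 0 hc hε (by norm_num) x) (j + 2) s τ) := by
  set y := KK c ε 0 hc hε (by norm_num) x with hy
  apply Ev_of
  rw [← intervalIntegral.integral_ofReal]
  push_cast
  have hcomb : ∀ τ, (ε:ℂ) * ((Ev x j s τ : ℂ) + c * (Ev y (j+2) s τ : ℂ)) = ε * (ev x j s τ + c * ev y (j+2) s τ) := by
    intro τ; rw [coe_Ev, coe_Ev]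
  simp_rw [hcomb]
  have key := intervalIntegral.hasSum_integral_of_dominated_convergence
    (μ := volume) (a := 0) (b := t)
    (F := fun (k:ℤ) τ => (ε:ℂ) * ((Complex.I * k) ^ j * coef x k (pt τ) * ee k s + c * ((Complex.I * k) ^ (j+2) * coef y k (pt τ) * ee k s)))
    (f := fun τ => (ε:ℂ) * (ev x j s τ + c * ev y (j+2) s τ))
    (fun k _ => ε * (|(k:ℝ)| ^ j * ‖coef x k‖ + c * (|(k:ℝ)| ^ (j+2) * ‖coef y k‖)))
    (fun k => by
      have h1 : Continuous fun τ : ℝ => coef x k (pt τ) := (coef x k).continuous.comp continuous_pt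
      have h2 : Continuous fun τ : ℝ => coef y k (pt τ) := (coef y k).continuous.comp continuous_pt
      exact Continuous.aestronglyMeasurable (continuous_const.mul (((continuous_const.mul h1).mul continuous_const).add
        (continuous_const.mul ((continuous_const.mul h2).mul continuous_const)))))
    (fun k => Eventually.of_forall fun τ _ => by
      rw [norm_mul, Complex.norm_real, Real.norm_of_nonneg hε.le]
      gcongr
      refine (norm_add_le _ _).trans (add_le_add (ev_term_norm x j k s τ) ?_)
      rw [norm_mul, Complex.norm_real, Real.norm_of_nonneg hc.le]
      gcongr
      exact ev_term_norm y (j+2) k s τ)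
    (Eventually.of_forall fun τ _ => ((summable_pow_coef x j).add ((summable_pow_coef y (j+2)).mul_left c)).mul_left ε)
    (intervalIntegrable_const)
    (Eventually.of_forall fun τ _ =>
      ((summable_ev x j s τ).hasSum.add ((summable_ev y (j+2) s τ).hasSum.mul_left (c:ℂ))).mul_left (ε:ℂ))
  rw [← key.tsum_eq, ev]
  refine tsum_congr fun k => ?_
  set l := c * ε * (k:ℝ)^2 with hl
  have e1 : ∀ τ ∈ Icc (0:ℝ) 1, coef y k (pt τ) = ε * U l (coef x k) τ := by
    intro τ hτ
    rw [hy, coef_KK, Mk, pow_zero, one_mul, ContinuousMap.smul_apply, UB_pt _ _ hτ, smul_eq_mul]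
  have e2 : ∫ τ in (0:ℝ)..t, (ε:ℂ) * ((Complex.I * k) ^ j * coef x k (pt τ) * ee k s + c * ((Complex.I * k) ^ (j+2) * coef y k (pt τ) * ee k s))
     = ∫ τ in (0:ℝ)..t, ((ε:ℂ) * (Complex.I * k) ^ j * ee k s) * (coef x k (pt τ) - l * U l (coef x k) τ) := by
    refine intervalIntegral.integral_congr fun τ hτ => ?_
    rw [uIcc_of_le ht.1] at hτ
    beta_reduce
    rw [e1 τ ⟨hτ.1, hτ.2.trans ht.2⟩, hl, pow_add, show (Complex.I * (k:ℂ)) ^ 2 = -(k:ℂ) ^ 2 by rw [mul_pow, Complex.I_sq]; ring]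
    push_cast
    ring
  rw [e2, intervalIntegral.integral_const_mul, U_integral, e1 t ht]
  ring

theorem hasDerivWithinAt_Ev_KK (c ε : ℝ) (hc : 0 < c) (hε : 0 < ε) (x : WA W) (j : ℕ) (s t : ℝ)
    (ht : t ∈ Icc (0:ℝ) 1) :
    HasDerivWithinAt (fun t => Ev (KK c ε 0 hc hε (by norm_num) x) j s t)
      (ε * (Ev x j s t + c * Ev (KK c ε 0 hc hε (by norm_num) x) (j + 2) s t)) (Icc 0 1) t := by
  have hc1 : Continuous fun τ => ε * (Ev x j s τ + c * Ev (KK c ε 0 hc hε (by norm_num) x) (j + 2) s τ) := by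
    have h1 := (continuous_Ev x j).comp (Continuous.prodMk_right s)
    have h2 := (continuous_Ev (KK c ε 0 hc hε (by norm_num) x) (j+2)).comp (Continuous.prodMk_right s)
    exact continuous_const.mul (h1.add (continuous_const.mul h2))
  have := (hc1.integral_hasStrictDerivAt 0 t).hasDerivAt.hasDerivWithinAt (s := Icc 0 1)
  exact this.congr (fun τ hτ => Ev_KK_integral c ε hc hε x j s τ hτ) (Ev_KK_integral c ε hc hε x j s t ht)

theorem Ev_KK_zero (c ε : ℝ) (hc : 0 < c) (hε : 0 < ε) (x : WA W) (j : ℕ) (s : ℝ) :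
    Ev (KK c ε 0 hc hε (by norm_num) x) j s 0 = 0 := by
  rw [Ev_KK_integral c ε hc hε x j s 0 (by simp)]; simp

end GP

namespace GP
variable {W : Weight}

theorem abstract_fp {A : Type*} [NormedCommRing A] [NormedAlgebra ℝ A] [CompleteSpace A]
    (F B : A × A → A) (c δ L κ R : ℝ) (v2 : A) (hc : 0 < c) (hL : 0 ≤ L) (hκ : 0 ≤ κ)
    (hR0 : 0 ≤ R)
    (hF0 : F 0 = 0)
    (hF : ∀ x y, ‖x‖ ≤ δ → ‖y‖ ≤ δ → ‖F x - F y‖ ≤ L * ‖x - y‖)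
    (hB : ∀ x y, ‖x‖ ≤ δ → ‖y‖ ≤ δ → ‖B x - B y‖ ≤ L * ‖x - y‖)
    (k0 k1 k2 : A →L[ℝ] A) (h0 : ∀ x, ‖k0 x‖ ≤ κ * ‖x‖) (h1 : ∀ x, ‖k1 x‖ ≤ κ * ‖x‖)
    (h2 : ∀ x, ‖k2 x‖ ≤ 1 / c * ‖x‖)
    (hR : c * ‖v2‖ + ‖B 0‖ + 1 ≤ R)
    (c1 : κ * R ≤ δ) (c2 : L * (κ * R) * (‖v2‖ + R / c + 1) ≤ 1)
    (c3 : L * κ * (‖v2‖ + 2 * R / c + 1) ≤ 1 / 2) :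
    ∃ f : A, ‖(k0 f, k1 f)‖ ≤ δ ∧ c • v2 + F (k0 f, k1 f) * (v2 + k2 f) + B (k0 f, k1 f) = f := by
  have hδ : 0 ≤ δ := (mul_nonneg hκ hR0).trans c1
  let Φ : A → A := fun f => c • v2 + F (k0 f, k1 f) * (v2 + k2 f) + B (k0 f, k1 f)
  have hk : ∀ f, ‖(k0 f, k1 f)‖ ≤ κ * ‖f‖ := fun f => by
    rw [Prod.norm_def]; exact max_le (h0 f) (h1 f)
  have hkd : ∀ f g, ‖(k0 f, k1 f) - (k0 g, k1 g)‖ ≤ κ * ‖f - g‖ := fun f g => by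
    have := hk (f - g)
    rwa [map_sub, map_sub] at this
  have hkR : ∀ f, ‖f‖ ≤ R → ‖(k0 f, k1 f)‖ ≤ κ * R := fun f hf =>
    (hk f).trans (mul_le_mul_of_nonneg_left hf hκ)
  have hF1 : ∀ f, ‖f‖ ≤ R → ‖F (k0 f, k1 f)‖ ≤ L * (κ * R) := fun f hf => by
    have := hF (k0 f, k1 f) 0 ((hkR f hf).trans c1) (by rw [norm_zero]; exact hδ)
    rw [hF0, sub_zero, sub_zero] at this
    exact this.trans (mul_le_mul_of_nonneg_left (hkR f hf) hL)
  have hB1 : ∀ f, ‖f‖ ≤ R → ‖B (k0 f, k1 f)‖ ≤ ‖B 0‖ + L * (κ * R) := fun f hf => by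
    have := hB (k0 f, k1 f) 0 ((hkR f hf).trans c1) (by rw [norm_zero]; exact hδ)
    rw [sub_zero] at this
    have h3 := this.trans (mul_le_mul_of_nonneg_left (hkR f hf) hL)
    have h4 := norm_le_norm_add_norm_sub (B 0) (B (k0 f, k1 f))
    rw [norm_sub_rev] at h4
    linarith [norm_le_norm_add_norm_sub' (B (k0 f, k1 f)) (B 0)]
  have hv : ∀ f, ‖f‖ ≤ R → ‖v2 + k2 f‖ ≤ ‖v2‖ + R / c := fun f hf => by
    refine (norm_add_le _ _).trans (add_le_add le_rfl ((h2 f).trans ?_))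
    rw [one_div, inv_mul_eq_div]
    gcongr
  have hRc : 0 ≤ R / c := by positivity
  have hmaps : MapsTo Φ (Metric.closedBall 0 R) (Metric.closedBall 0 R) := by
    intro f hf
    rw [mem_closedBall_zero_iff] at hf ⊢
    have n1 : ‖F (k0 f, k1 f) * (v2 + k2 f)‖ ≤ L * (κ * R) * (‖v2‖ + R / c) :=
      (norm_mul_le _ _).trans (mul_le_mul (hF1 f hf) (hv f hf) (norm_nonneg _) (by positivity))
    have n2 : ‖c • v2‖ = c * ‖v2‖ := by rw [norm_smul, Real.norm_of_nonneg hc.le]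
    have n3 : ‖Φ f‖ ≤ ‖c • v2‖ + ‖F (k0 f, k1 f) * (v2 + k2 f)‖ + ‖B (k0 f, k1 f)‖ := norm_add₃_le
    have := hB1 f hf
    nlinarith
  have hcontr : ∀ f g, ‖f‖ ≤ R → ‖g‖ ≤ R → ‖Φ f - Φ g‖ ≤ 1 / 2 * ‖f - g‖ := by
    intro f g hf hg
    have e : Φ f - Φ g = (F (k0 f, k1 f) - F (k0 g, k1 g)) * (v2 + k2 f) + F (k0 g, k1 g) * k2 (f - g)
        + (B (k0 f, k1 f) - B (k0 g, k1 g)) := by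
      simp only [Φ, map_sub]; ring
    have d1 : ‖F (k0 f, k1 f) - F (k0 g, k1 g)‖ ≤ L * (κ * ‖f - g‖) :=
      (hF _ _ ((hkR f hf).trans c1) ((hkR g hg).trans c1)).trans (mul_le_mul_of_nonneg_left (hkd f g) hL)
    have d2 : ‖B (k0 f, k1 f) - B (k0 g, k1 g)‖ ≤ L * (κ * ‖f - g‖) :=
      (hB _ _ ((hkR f hf).trans c1) ((hkR g hg).trans c1)).trans (mul_le_mul_of_nonneg_left (hkd f g) hL)
    have d3 : ‖(F (k0 f, k1 f) - F (k0 g, k1 g)) * (v2 + k2 f)‖ ≤ L * (κ * ‖f - g‖) * (‖v2‖ + R / c) :=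
      (norm_mul_le _ _).trans (mul_le_mul d1 (hv f hf) (norm_nonneg _) (by positivity))
    have d4 : ‖F (k0 g, k1 g) * k2 (f - g)‖ ≤ L * (κ * R) * (1 / c * ‖f - g‖) :=
      (norm_mul_le _ _).trans (mul_le_mul (hF1 g hg) (h2 _) (norm_nonneg _) (by positivity))
    rw [e]
    refine norm_add₃_le.trans ?_
    have d5 := mul_le_mul_of_nonneg_right c3 (norm_nonneg (f - g))
    calc _ ≤ L * (κ * ‖f - g‖) * (‖v2‖ + R / c) + L * (κ * R) * (1 / c * ‖f - g‖) + L * (κ * ‖f - g‖) := by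
          linarith
      _ = L * κ * (‖v2‖ + 2 * R / c + 1) * ‖f - g‖ := by ring
      _ ≤ _ := d5
  have hcw : ContractingWith (1/2 : NNReal) (hmaps.restrict Φ (Metric.closedBall 0 R) (Metric.closedBall 0 R)) := by
    refine ⟨by rw [← NNReal.coe_lt_coe]; norm_num, LipschitzWith.of_dist_le_mul fun f g => ?_⟩
    have := hcontr f g (mem_closedBall_zero_iff.1 f.2) (mem_closedBall_zero_iff.1 g.2)
    rw [Subtype.dist_eq, Subtype.dist_eq, dist_eq_norm, dist_eq_norm]
    simpa using this
  obtain ⟨f, hf, hfix, -⟩ := ContractingWith.exists_fixedPoint' (Metric.isClosed_closedBall.isComplete) hmaps hcw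
    (x := 0) (by simp [hR0]) (edist_ne_top _ _)
  rw [mem_closedBall_zero_iff] at hf
  exact ⟨f, (hkR f hf).trans c1, hfix⟩

theorem lip_of_contDiffAt {A : Type*} [NormedCommRing A] [NormedAlgebra ℝ A]
    {F : A × A → A} (hF : ContDiffAt ℝ 1 F 0) :
    ∃ δ > 0, ∃ L, 0 ≤ L ∧ ∀ x y, ‖x‖ ≤ δ → ‖y‖ ≤ δ → ‖F x - F y‖ ≤ L * ‖x - y‖ := by
  obtain ⟨K, t, ht, hl⟩ := hF.exists_lipschitzOnWith
  obtain ⟨δ, hδ, hb⟩ := Metric.nhds_basis_closedBall.mem_iff.1 ht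
  refine ⟨δ, hδ, K, K.2, fun x y hx hy => ?_⟩
  have := hl.dist_le_mul x (hb (mem_closedBall_zero_iff.2 hx)) y (hb (mem_closedBall_zero_iff.2 hy))
  rwa [dist_eq_norm, dist_eq_norm] at this

theorem exists_fp (F B : WA W × WA W → WA W) (c ρ : ℝ) (v2 : WA W) (hc : 0 < c) (hρ : 0 < ρ)
    (hF0 : F 0 = 0) (hF : ContDiffAt ℝ 1 F 0) (hB : ContDiffAt ℝ 1 B 0) :
    ∃ (ε : ℝ) (hε : 0 < ε) (f : WA W),
      ‖(KK c ε 0 hc hε (by norm_num) f, KK c ε 1 hc hε (by norm_num) f)‖ ≤ ρ ∧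
      c • v2 + F (KK c ε 0 hc hε (by norm_num) f, KK c ε 1 hc hε (by norm_num) f)
          * (v2 + KK c ε 2 hc hε (by norm_num) f)
        + B (KK c ε 0 hc hε (by norm_num) f, KK c ε 1 hc hε (by norm_num) f) = f := by
  obtain ⟨δ1, hδ1, L1, hL1, hl1⟩ := lip_of_contDiffAt hF
  obtain ⟨δ2, hδ2, L2, hL2, hl2⟩ := lip_of_contDiffAt hB
  set δ := min ρ (min δ1 δ2) with hδdef
  have hδ : 0 < δ := lt_min hρ (lt_min hδ1 hδ2)
  set L := L1 + L2 with hLdef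
  set R := c * ‖v2‖ + ‖B 0‖ + 1 with hRdef
  have hR : 0 < R := by positivity
  set S := ‖v2‖ + 2 * R / c + 1 with hS
  have hSpos : 0 < S := by positivity
  have hLn : 0 ≤ L := by positivity
  set κ := min (δ / R) (1 / (2 * (L + 1) * (R + 1) * S)) with hκdef
  have hκ : 0 < κ := lt_min (by positivity) (by positivity)
  have hκ1 : κ * R ≤ δ := by
    rw [← le_div_iff₀ hR]; exact min_le_left _ _
  have hκ2 : κ * (2 * (L + 1) * (R + 1) * S) ≤ 1 := by
    rw [← le_div_iff₀ (by positivity)]; exact min_le_right _ _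
  have hε : 0 < min κ (c * κ ^ 2) := lt_min hκ (by positivity)
  set ε := min κ (c * κ ^ 2) with hεdef
  refine ⟨ε, hε, ?_⟩
  have hRc : 0 ≤ R / c := by positivity
  have hRc2 : 2 * R / c = 2 * (R / c) := by ring
  obtain ⟨f, h1, h2⟩ := abstract_fp F B c δ L κ R v2 hc hLn hκ.le hR.le hF0
    (fun x y hx hy => (hl1 x y (hx.trans ((min_le_right _ _).trans (min_le_left _ _))) (hy.trans ((min_le_right _ _).trans (min_le_left _ _)))).trans
      (mul_le_mul_of_nonneg_right (by linarith) (norm_nonneg _)))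
    (fun x y hx hy => (hl2 x y (hx.trans ((min_le_right _ _).trans (min_le_right _ _))) (hy.trans ((min_le_right _ _).trans (min_le_right _ _)))).trans
      (mul_le_mul_of_nonneg_right (by linarith) (norm_nonneg _)))
    (KK c ε 0 hc hε (by norm_num)) (KK c ε 1 hc hε (by norm_num)) (KK c ε 2 hc hε (by norm_num))
    (fun x => (norm_KK_le c ε 0 hc hε _ x).trans (mul_le_mul_of_nonneg_right (by
      simp only [Kb, if_true]; exact min_le_left _ _) (norm_nonneg _)))
    (fun x => (norm_KK_le c ε 1 hc hε _ x).trans (mul_le_mul_of_nonneg_right (by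
      simp only [Kb, one_ne_zero, if_true, if_false]
      rw [Real.sqrt_le_left hκ.le, div_le_iff₀ hc, mul_comm]
      exact min_le_right _ _) (norm_nonneg _)))
    (fun x => by simpa [Kb] using norm_KK_le c ε 2 hc hε (by norm_num) x)
    le_rfl hκ1 (by
      have : L * (κ * R) * (‖v2‖ + R / c + 1) ≤ (L + 1) * (κ * (R + 1)) * S := by
        gcongr <;> linarith
      nlinarith) (by
      have : L * κ * S ≤ (L + 1) * κ * S * (R + 1) := by
        have h1 : L * κ * S ≤ (L + 1) * κ * S := by gcongr; linarith
        have h2 : 0 ≤ (L + 1) * κ * S := by positivity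
        nlinarith
      nlinarith)
  exact ⟨f, h1.trans (min_le_left _ _), h2⟩

end GP

namespace GP

theorem exists_local_sqrt {A : Type*} [NormedCommRing A] [NormedAlgebra ℝ A] [CompleteSpace A]
    (g i : A) (hgi : g * i = 1) :
    ∃ S : A → A, ContDiffAt ℝ 1 S (g * g) ∧ S (g * g) = g ∧ ∀ᶠ y in nhds (g * g), S y * S y = y := by
  have hig : i * g = 1 := by rw [mul_comm]; exact hgi
  let e : A ≃L[ℝ] A := ContinuousLinearEquiv.equivOfInverse
    (ContinuousLinearMap.mul ℝ A ((2:ℝ) • g)) (ContinuousLinearMap.mul ℝ A ((2⁻¹:ℝ) • i))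
    (fun x => by
      simp only [ContinuousLinearMap.mul_apply']
      rw [← mul_assoc, smul_mul_smul_comm, hig]; simp)
    (fun x => by
      simp only [ContinuousLinearMap.mul_apply']
      rw [← mul_assoc, smul_mul_smul_comm, hgi]; simp)
  have hc : ContDiffAt ℝ 1 (fun x : A => x * x) g := (contDiff_id.mul contDiff_id).contDiffAt
  have hd : HasFDerivAt (fun x : A => x * x) (e : A →L[ℝ] A) g := by
    have h := (hasFDerivAt_id (𝕜 := ℝ) g).mul (hasFDerivAt_id (𝕜 := ℝ) g)
    refine h.congr_fderiv ?_
    ext x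
    show g • x + g • x = ((2:ℝ) • g) * x
    rw [smul_eq_mul, two_smul, add_mul]
  refine ⟨hc.localInverse hd one_ne_zero, hc.to_localInverse hd one_ne_zero,
    hc.localInverse_apply_image hd one_ne_zero, ?_⟩
  exact (hc.hasStrictFDerivAt' hd one_ne_zero).eventually_right_inverse

variable {W : Weight}

theorem inv_pt {x y : WA W} (h : x * y = 1) (s t : ℝ) : Ev x 0 s t * Ev y 0 s t = 1 := by
  rw [← Ev_mul, h, Ev_one]

def Ypt (p v vs : ℝ) : ℝ := v ^ 2 + p ^ 2 * vs ^ 2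

theorem Ypt_pos {p v vs : ℝ} (hv : 0 < v) : 0 < Ypt p v vs := by unfold Ypt; positivity

/-- right-hand side in the static arclength coordinate; `m` is the length integral -/
def Rpt (p p1 v vs vss m : ℝ) : ℝ :=
  (p ^ 2 * vss + p * p1 * vs - 2 * p ^ 2 * vs ^ 2 / v - v) / Ypt p v vs
    + 2 * π * √(Ypt p v vs) / (v * m)

set_option maxHeartbeats 1000000 in
theorem exists_solution (v0 p : ℝ → ℝ) (hv0 : SP v0) (hp : SP p) (hv0p : ∀ s, 0 < v0 s) (hpp : ∀ s, 0 < p s)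
    (a : ℝ) (ha : 0 < a) (hpa : ∀ s, p s ^ 2 = a ^ 2 * Ypt (p s) (v0 s) (deriv v0 s)) :
    ∃ (W : Weight) (P H : WA W) (ε : ℝ), 0 < ε ∧ (∀ j s, Ev P j s 0 = 0) ∧
      (∀ s t, 0 < v0 s + Ev P 0 s t) ∧
      (∀ j s, ∀ t ∈ Icc (0:ℝ) 1, HasDerivWithinAt (fun t => Ev P j s t) (Ev H j s t) (Icc 0 1) t) ∧
      ∀ s t, Ev H 0 s t = ε * Rpt (p s) (deriv p s) (v0 s + Ev P 0 s t) (deriv v0 s + Ev P 1 s t)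
        (deriv (deriv v0) s + Ev P 2 s t)
        (∫ u in (0:ℝ)..(2 * π), √(Ypt (p u) (v0 u + Ev P 0 u t) (deriv v0 u + Ev P 1 u t)) / p u) := by
  have hinv : ∀ {g : ℝ → ℝ}, SP g → (∀ s, 0 < g s) → SP fun s => (g s)⁻¹ := fun {g} hg hpos =>
    ⟨hg.1.inv fun s => (hpos s).ne', fun s => by simp only [hg.2 s]⟩
  obtain ⟨W, X, hX⟩ := exists_embed (ι := Fin 7)
    ![v0, deriv v0, deriv (deriv v0), p, deriv p, fun s => (p s)⁻¹, fun s => (v0 s)⁻¹] (by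
      intro i
      fin_cases i
      · exact hv0
      · exact hv0.deriv
      · exact hv0.deriv.deriv
      · exact hp
      · exact hp.deriv
      · exact hinv hp hpp
      · exact hinv hv0 hv0p)
  obtain ⟨xv, hxv⟩ : ∃ x : WA W, ∀ s t, Ev x 0 s t = v0 s := ⟨X 0, hX 0⟩
  obtain ⟨xz, hxz⟩ : ∃ x : WA W, ∀ s t, Ev x 0 s t = deriv v0 s := ⟨X 1, hX 1⟩
  obtain ⟨x2, hx2⟩ : ∃ x : WA W, ∀ s t, Ev x 0 s t = deriv (deriv v0) s := ⟨X 2, hX 2⟩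
  obtain ⟨xp, hxp⟩ : ∃ x : WA W, ∀ s t, Ev x 0 s t = p s := ⟨X 3, hX 3⟩
  obtain ⟨xq, hxq⟩ : ∃ x : WA W, ∀ s t, Ev x 0 s t = deriv p s := ⟨X 4, hX 4⟩
  obtain ⟨xi, hxi⟩ : ∃ x : WA W, ∀ s t, Ev x 0 s t = (p s)⁻¹ := ⟨X 5, hX 5⟩
  obtain ⟨xw, hxw⟩ : ∃ x : WA W, ∀ s t, Ev x 0 s t = (v0 s)⁻¹ := ⟨X 6, hX 6⟩
  clear hX X
  -- the static metric
  set g0 : WA W := a⁻¹ • xp with hg0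
  have hg0i : g0 * (a • xi) = 1 := Ev_inj fun s t => by
    rw [Ev_mul, hg0, Ev_smul, Ev_smul, hxp, hxi, Ev_one]
    have := (hpp s).ne'
    field_simp
  have hg0sq : g0 * g0 = xv * xv + xp * xp * (xz * xz) := Ev_inj fun s t => by
    rw [Ev_mul, hg0, Ev_smul, Ev_add, Ev_mul, Ev_mul, Ev_mul, Ev_mul, hxp, hxv, hxz]
    have := hpa s
    rw [Ypt] at this
    field_simp
    linarith
  obtain ⟨S, hS1, hS2, hS3⟩ := exists_local_sqrt g0 _ hg0i
  -- nonlinear maps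
  let v : WA W × WA W → WA W := fun X => xv + X.1
  let z : WA W × WA W → WA W := fun X => xz + X.2
  let Y : WA W × WA W → WA W := fun X => v X * v X + xp * xp * (z X * z X)
  let q : WA W × WA W → WA W := fun X => Ring.inverse (v X * Y X)
  let G : WA W × WA W → WA W := fun X => S (Y X)
  let M : WA W × WA W → WA W := fun X => Mean (G X * xi)
  let l : WA W × WA W → WA W := fun X => Ring.inverse (M X)
  let F : WA W × WA W → WA W := fun X => xp * xp * v X * q X - (a ^ 2) • 1
  let B : WA W × WA W → WA W := fun X =>
    (xp * xq * z X * v X - (2:ℝ) • (xp * xp * (z X * z X)) - v X * v X) * q X + G X * Y X * q X * l X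
  have hv0' : v 0 = xv := by simp [v]
  have hz0' : z 0 = xz := by simp [z]
  have hY0' : Y 0 = g0 * g0 := by rw [hg0sq]; simp only [Y, hv0', hz0']
  have hG0' : G 0 = g0 := by simp only [G, hY0', hS2]
  have hM0' : M 0 = a⁻¹ • 1 := by
    apply Ev_inj
    intro s t
    simp only [M, hG0']
    rw [Ev_Mean, Ev_smul, Ev_one]
    have : ∀ u, Ev (g0 * xi) 0 u t = a⁻¹ := by
      intro u
      rw [Ev_mul, hg0, Ev_smul, hxp, hxi]
      have := (hpp u).ne'
      field_simp
    simp_rw [this]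
    rw [intervalIntegral.integral_const, smul_eq_mul]
    have := Real.pi_pos
    field_simp; ring
  have hY0i : v 0 * Y 0 * (xw * ((a • xi) * (a • xi))) = 1 := by
    rw [hv0', hY0']
    have h1 : xv * xw = 1 := Ev_inj fun s t => by
      rw [Ev_mul, hxv, hxw, Ev_one, mul_inv_cancel₀ (hv0p s).ne']
    calc _ = (xv * xw) * (g0 * (a • xi)) * (g0 * (a • xi)) := by ring
      _ = 1 := by rw [h1, hg0i]; ring
  have hM0i : M 0 * (a • 1) = 1 := by
    rw [hM0', smul_mul_smul_comm, inv_mul_cancel₀ ha.ne', one_mul, one_smul]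
  -- smoothness
  have cv : ContDiff ℝ 1 v := contDiff_const.add contDiff_fst
  have cz : ContDiff ℝ 1 z := contDiff_const.add contDiff_snd
  have cY : ContDiff ℝ 1 Y := (cv.mul cv).add (contDiff_const.mul (cz.mul cz))
  have uVY : IsUnit (v 0 * Y 0) := IsUnit.of_mul_eq_one _ hY0i
  have uM : IsUnit (M 0) := IsUnit.of_mul_eq_one _ hM0i
  have cq : ContDiffAt ℝ 1 q 0 := by
    obtain ⟨u, hu⟩ := uVY
    have h1 := contDiffAt_ringInverse ℝ (n := 1) u
    rw [hu] at h1
    exact ContDiffAt.comp (0 : WA W × WA W) (f := fun X => v X * Y X) h1 (cv.mul cY).contDiffAt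
  have cG : ContDiffAt ℝ 1 G 0 := by
    rw [← hY0'] at hS1
    exact ContDiffAt.comp (0 : WA W × WA W) (f := Y) hS1 cY.contDiffAt
  have cM : ContDiffAt ℝ 1 M 0 := by
    have : ContDiffAt ℝ 1 (fun X => G X * xi) 0 := cG.mul contDiffAt_const
    exact (Mean (W := W)).contDiff.contDiffAt.comp (0 : WA W × WA W) this
  have cl : ContDiffAt ℝ 1 l 0 := by
    obtain ⟨u, hu⟩ := uM
    have h1 := contDiffAt_ringInverse ℝ (n := 1) u
    rw [hu] at h1
    exact ContDiffAt.comp (0 : WA W × WA W) (f := M) h1 cM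
  have cF : ContDiffAt ℝ 1 F 0 :=
    (((contDiff_const.mul cv).contDiffAt).mul cq).sub contDiffAt_const
  have cB : ContDiffAt ℝ 1 B 0 := by
    refine ContDiffAt.add (ContDiffAt.mul ?_ cq) (((cG.mul cY.contDiffAt).mul cq).mul cl)
    have b1 : ContDiff ℝ 1 fun X => xp * xq * z X * v X := (contDiff_const.mul cz).mul cv
    have b2 : ContDiff ℝ 1 fun X => xp * xp * (z X * z X) := contDiff_const.mul (cz.mul cz)
    have b3 : ContDiff ℝ 1 fun X => (2:ℝ) • (xp * xp * (z X * z X)) := b2.const_smul (2:ℝ)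
    exact ((b1.sub b3).sub (cv.mul cv)).contDiffAt
  have hF0 : F 0 = 0 := by
    have h1 := Ring.inverse_mul_cancel _ uVY
    have h2 : xp * xp = (a ^ 2) • (Y 0) := by
      rw [hY0', hg0, smul_mul_smul_comm, smul_smul]
      have : a ^ 2 * (a⁻¹ * a⁻¹) = 1 := by field_simp
      rw [this, one_smul]
    show xp * xp * v 0 * q 0 - (a ^ 2) • 1 = 0
    rw [h2, smul_mul_assoc, smul_mul_assoc, ← smul_sub]
    have : Y 0 * v 0 * q 0 = 1 := by
      rw [← h1]; simp only [q]; ring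
    rw [this, sub_self, smul_zero]
  -- neighbourhood
  obtain ⟨C, hC, hCb⟩ := exists_abs_Ev_le W
  have lower : ∀ g : ℝ → ℝ, SP g → (∀ s, 0 < g s) → ∃ m > 0, ∀ s, m ≤ g s := by
    intro g hg hgp
    obtain ⟨x, hx⟩ := IsCompact.exists_isMinOn (isCompact_Icc (a := (0:ℝ)) (b := 2 * π))
      ⟨0, by simp [Real.pi_pos.le]⟩ hg.1.continuous.continuousOn
    refine ⟨g x, hgp x, fun s => ?_⟩
    obtain ⟨y, hy, hys⟩ := hg.2.exists_mem_Ico₀ Real.two_pi_pos s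
    rw [hys]
    exact hx.2 ⟨hy.1, hy.2.le⟩
  obtain ⟨m1, hm1, hm1b⟩ := lower v0 hv0 hv0p
  obtain ⟨m2, hm2, hm2b⟩ := lower p hp hpp
  have pos_near : ∀ (u : WA W × WA W → WA W) (b : ℝ → ℝ) (m : ℝ), 0 < m → (∀ s, m ≤ b s) →
      (∀ s t, Ev (u 0) 0 s t = b s) → ContinuousAt u 0 → ∀ᶠ X in nhds 0, ∀ s t, 0 < Ev (u X) 0 s t := by
    intro u b m hm hb hu hcont
    have h1 : ∀ᶠ X in nhds (0 : WA W × WA W), ‖u X - u 0‖ < m / C := by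
      have := Metric.tendsto_nhds.1 hcont (m / C) (by positivity)
      simpa [dist_eq_norm] using this
    filter_upwards [h1] with X hX s t
    have h2 := hCb (u X - u 0) s t
    rw [Ev_sub, hu] at h2
    rw [lt_div_iff₀' hC] at hX
    have := hb s
    have := abs_le.1 h2
    linarith [this.1]
  have n1 : ∀ᶠ X in nhds 0, ∀ s t, 0 < Ev (v X) 0 s t :=
    pos_near v v0 m1 hm1 hm1b (fun s t => by rw [hv0', hxv]) cv.continuous.continuousAt
  have n2 : ∀ᶠ X in nhds 0, ∀ s t, 0 < Ev (G X) 0 s t :=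
    pos_near G (fun s => a⁻¹ * p s) (a⁻¹ * m2) (by positivity)
      (fun s => mul_le_mul_of_nonneg_left (hm2b s) (by positivity))
      (fun s t => by rw [hG0', hg0, Ev_smul, hxp]) cG.continuousAt
  have n3 : ∀ᶠ X in nhds 0, IsUnit (v X * Y X) :=
    (cv.mul cY).continuous.continuousAt.eventually (Units.isOpen.mem_nhds uVY)
  have n4 : ∀ᶠ X in nhds 0, IsUnit (M X) :=
    cM.continuousAt.eventually (Units.isOpen.mem_nhds uM)
  have n5 : ∀ᶠ X in nhds 0, G X * G X = Y X := by
    rw [← hY0'] at hS3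
    exact cY.continuous.continuousAt.eventually hS3
  obtain ⟨ρ, hρ, hball⟩ := Metric.nhds_basis_closedBall.mem_iff.1 (n1.and (n2.and (n3.and (n4.and n5))))
  obtain ⟨ε, hε, f, hf1, hf2⟩ := exists_fp F B (a ^ 2) ρ x2 (by positivity) hρ hF0 cF cB
  set P := KK (W := W) (a ^ 2) ε 0 (by positivity) hε (by norm_num) f with hP
  set Q := KK (W := W) (a ^ 2) ε 1 (by positivity) hε (by norm_num) f with hQ
  set T := KK (W := W) (a ^ 2) ε 2 (by positivity) hε (by norm_num) f with hT
  obtain ⟨k1, k2, k3, k4, k5⟩ := hball (mem_closedBall_zero_iff.2 hf1)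
  have eQ : ∀ j s t, Ev Q j s t = Ev P (1 + j) s t := fun j s t => Ev_KK _ _ 1 _ _ _ f j s t
  have eT : ∀ j s t, Ev T j s t = Ev P (2 + j) s t := fun j s t => Ev_KK _ _ 2 _ _ _ f j s t
  have evv : ∀ s t, Ev (v (P, Q)) 0 s t = v0 s + Ev P 0 s t := fun s t => by
    simp only [v]; rw [Ev_add, hxv]
  have evz : ∀ s t, Ev (z (P, Q)) 0 s t = deriv v0 s + Ev P 1 s t := fun s t => by
    simp only [z]; rw [Ev_add, hxz, eQ]
  have evY : ∀ s t, Ev (Y (P, Q)) 0 s t = Ypt (p s) (v0 s + Ev P 0 s t) (deriv v0 s + Ev P 1 s t) := fun s t => by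
    simp only [Y]; rw [Ev_add, Ev_mul, Ev_mul, Ev_mul, Ev_mul, evv, evz, hxp, Ypt]; ring
  have evG : ∀ s t, Ev (G (P, Q)) 0 s t = √(Ypt (p s) (v0 s + Ev P 0 s t) (deriv v0 s + Ev P 1 s t)) := fun s t => by
    rw [← evY, ← k5, Ev_mul, Real.sqrt_mul_self (k2 s t).le]
  have evM : ∀ s t, Ev (M (P, Q)) 0 s t = (2 * π)⁻¹ *
      (∫ u in (0:ℝ)..(2 * π), √(Ypt (p u) (v0 u + Ev P 0 u t) (deriv v0 u + Ev P 1 u t)) / p u) := fun s t => by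
    simp only [M]; rw [Ev_Mean]; congr 1
    refine intervalIntegral.integral_congr fun u _ => ?_
    show Ev (G (P, Q) * xi) 0 u t = _
    rw [Ev_mul, evG, hxi, div_eq_mul_inv]
  refine ⟨W, P, ε • (f + (a ^ 2) • T), ε, hε, fun j s => Ev_KK_zero _ _ _ _ f j s, fun s t => ?_, ?_, ?_⟩
  · rw [← evv]; exact k1 s t
  · intro j s t ht
    have := hasDerivWithinAt_Ev_KK (a ^ 2) ε (by positivity) hε f j s t ht
    rw [Ev_smul, Ev_add, Ev_smul, eT, add_comm 2 j]
    exact this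
  · intro s t
    rw [Ev_smul]
    congr 1
    have hq := inv_pt (Ring.inverse_mul_cancel _ k3) s t
    have hl := inv_pt (Ring.inverse_mul_cancel _ k4) s t
    change Ev (q (P, Q)) 0 s t * Ev (v (P, Q) * Y (P, Q)) 0 s t = 1 at hq
    change Ev (l (P, Q)) 0 s t * Ev (M (P, Q)) 0 s t = 1 at hl
    rw [Ev_mul, evv, evY] at hq
    rw [evM] at hl
    have hvp := k1 s t
    rw [evv] at hvp
    have hyp := Ypt_pos (p := p s) (vs := deriv v0 s + Ev P 1 s t) hvp
    have ef : Ev f 0 s t = Ev ((a ^ 2) • x2 + F (P, Q) * (x2 + T) + B (P, Q)) 0 s t := by rw [hf2]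
    rw [Ev_add, ef]
    simp only [Ev_add, Ev_sub, Ev_smul, Ev_mul, F, B, Ev_one, hx2, hxp, hxq, evv, evz, evY, evG, eT]
    simp only [add_zero]
    rw [Rpt]
    generalize (∫ u in (0:ℝ)..(2 * π), √(Ypt (p u) (v0 u + Ev P 0 u t) (deriv v0 u + Ev P 1 u t)) / p u) = m at *
    generalize Ev (q (P, Q)) 0 s t = Q1 at *
    generalize Ev (l (P, Q)) 0 s t = l1 at *
    generalize √(Ypt (p s) (v0 s + Ev P 0 s t) (deriv v0 s + Ev P 1 s t)) = G1 at *
    generalize Ypt (p s) (v0 s + Ev P 0 s t) (deriv v0 s + Ev P 1 s t) = Y1 at *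
    generalize v0 s + Ev P 0 s t = V1 at *
    have hm : m ≠ 0 := by rintro rfl; simp at hl
    have hπ := Real.pi_pos
    have eq1 : Q1 = 1 / (V1 * Y1) := by field_simp; linarith
    have el1 : l1 = 2 * π / m := by
      rw [eq_div_iff hm]; field_simp at hl; linarith
    rw [eq1, el1]
    field_simp
    ring

end GP

namespace GP

/-- Functions generated from the basic ones. -/
inductive Good (V : ℕ → ℝ → ℝ → ℝ) : (ℝ → ℝ → ℝ) → Prop
  | base (j : ℕ) : Good V (V j)
  | static (g : ℝ → ℝ) (hg : ContDiff ℝ (⊤ : ℕ∞) g) : Good V (fun s _ => g s)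
  | add {u w : ℝ → ℝ → ℝ} (hu : Good V u) (hw : Good V w) : Good V (fun s t => u s t + w s t)
  | mul {u w : ℝ → ℝ → ℝ} (hu : Good V u) (hw : Good V w) : Good V (fun s t => u s t * w s t)
  | inv {u : ℝ → ℝ → ℝ} (hu : Good V u) (hpos : ∀ s t, 0 < u s t) : Good V (fun s t => (u s t)⁻¹)
  | sqrt {u : ℝ → ℝ → ℝ} (hu : Good V u) (hpos : ∀ s t, 0 < u s t) : Good V (fun s t => √(u s t))
  | mean {u : ℝ → ℝ → ℝ} (hu : Good V u) : Good V (fun _ t => ∫ x in (0:ℝ)..(2 * π), u x t)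

variable {V : ℕ → ℝ → ℝ → ℝ}

theorem Good.const (c : ℝ) : Good V (fun _ _ => c) := Good.static _ contDiff_const

theorem Good.neg {u : ℝ → ℝ → ℝ} (hu : Good V u) : Good V (fun s t => - u s t) := by
  have := (Good.const (V := V) (-1)).mul hu
  simpa using this

theorem Good.sub {u w : ℝ → ℝ → ℝ} (hu : Good V u) (hw : Good V w) : Good V (fun s t => u s t - w s t) := by
  have := hu.add hw.neg
  simpa [sub_eq_add_neg] using this

theorem Good.sq {u : ℝ → ℝ → ℝ} (hu : Good V u) : Good V (fun s t => u s t ^ 2) := by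
  have := hu.mul hu
  simpa [_root_.sq] using this

theorem Good.div {u w : ℝ → ℝ → ℝ} (hu : Good V u) (hw : Good V w) (hpos : ∀ s t, 0 < w s t) :
    Good V (fun s t => u s t / w s t) := by
  have := hu.mul (hw.inv hpos)
  simpa [div_eq_mul_inv] using this

theorem continuous_integral_param {u : ℝ → ℝ → ℝ} (hu : Continuous fun p : ℝ × ℝ => u p.1 p.2) (a b : ℝ) :
    Continuous fun t => ∫ x in a..b, u x t := by
  refine intervalIntegral.continuous_parametric_intervalIntegral_of_continuous' (f := fun t x => u x t) ?_ a b
  exact hu.comp continuous_swap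

theorem Good.continuous (hV : ∀ j, Continuous fun p : ℝ × ℝ => V j p.1 p.2) {u : ℝ → ℝ → ℝ} (hu : Good V u) :
    Continuous fun p : ℝ × ℝ => u p.1 p.2 := by
  induction hu with
  | base j => exact hV j
  | static g hg => exact hg.continuous.comp continuous_fst
  | add _ _ h1 h2 => exact h1.add h2
  | mul _ _ h1 h2 => exact h1.mul h2
  | inv _ hpos h => exact h.inv₀ fun p => (hpos p.1 p.2).ne'
  | sqrt _ hpos h => exact h.sqrt
  | mean _ h => exact (continuous_integral_param h 0 (2 * π)).comp continuous_snd

theorem Good.ds (hVs : ∀ j s t, HasDerivAt (fun s => V j s t) (V (j + 1) s t) s) {u : ℝ → ℝ → ℝ} (hu : Good V u) :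
    ∃ u1, Good V u1 ∧ ∀ s t, HasDerivAt (fun s => u s t) (u1 s t) s := by
  induction hu with
  | base j => exact ⟨_, Good.base (j + 1), hVs j⟩
  | static g hg =>
    have h := (contDiff_infty_iff_deriv (𝕜 := ℝ)).1 hg
    exact ⟨_, Good.static _ h.2, fun s t => (h.1 s).hasDerivAt⟩
  | add _ _ h1 h2 =>
    obtain ⟨u1, g1, d1⟩ := h1
    obtain ⟨w1, g2, d2⟩ := h2
    exact ⟨_, g1.add g2, fun s t => (d1 s t).add (d2 s t)⟩
  | mul k1 k2 h1 h2 =>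
    obtain ⟨u1, g1, d1⟩ := h1
    obtain ⟨w1, g2, d2⟩ := h2
    exact ⟨_, (g1.mul k2).add (k1.mul g2), fun s t => (d1 s t).mul (d2 s t)⟩
  | inv k hpos h =>
    obtain ⟨u1, g1, d1⟩ := h
    exact ⟨_, g1.neg.div k.sq (fun s t => pow_pos (hpos s t) 2), fun s t => (d1 s t).inv (hpos s t).ne'⟩
  | sqrt k hpos h =>
    obtain ⟨u1, g1, d1⟩ := h
    exact ⟨_, g1.div ((Good.const 2).mul (k.sqrt hpos)) (fun s t => mul_pos two_pos (Real.sqrt_pos.2 (hpos s t))),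
      fun s t => (d1 s t).sqrt (hpos s t).ne'⟩
  | mean k h => exact ⟨_, Good.const 0, fun s t => hasDerivAt_const _ _⟩

/-- differentiation under the integral sign, one-sided at the end points -/
theorem hasDerivWithinAt_integral {u u2 : ℝ → ℝ → ℝ} {T : ℝ} (hT : 0 ≤ T) (a b : ℝ)
    (hu : Continuous fun p : ℝ × ℝ => u p.1 p.2)
    (hu2 : Continuous fun p : ℝ × ℝ => u2 p.1 p.2)
    (hd : ∀ x, ∀ t ∈ Icc (0:ℝ) T, HasDerivWithinAt (fun t => u x t) (u2 x t) (Icc 0 T) t) :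
    ∀ t ∈ Icc (0:ℝ) T, HasDerivWithinAt (fun t => ∫ x in a..b, u x t) (∫ x in a..b, u2 x t) (Icc 0 T) t := by
  have hc := continuous_integral_param hu2 a b
  have key : ∀ t ∈ Icc (0:ℝ) T, ∫ x in a..b, u x t = (∫ x in a..b, u x 0) + ∫ τ in (0:ℝ)..t, ∫ x in a..b, u2 x τ := by
    intro t ht
    have h1 : ∀ x, u x t = u x 0 + ∫ τ in (0:ℝ)..t, u2 x τ := by
      intro x
      have hux : Continuous fun τ => u x τ := hu.comp (Continuous.prodMk_right x)
      have hu2x : Continuous fun τ => u2 x τ := hu2.comp (Continuous.prodMk_right x)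
      rw [intervalIntegral.integral_eq_sub_of_hasDerivAt_of_le ht.1 (f := fun τ => u x τ) hux.continuousOn
        (fun τ hτ => (hd x τ ⟨hτ.1.le, hτ.2.le.trans ht.2⟩).hasDerivAt
          (Icc_mem_nhds hτ.1 (hτ.2.trans_le ht.2))) (hu2x.intervalIntegrable _ _)]
      ring
    simp_rw [h1]
    have c1 : Continuous fun x => u x 0 := hu.comp (Continuous.prodMk_left 0)
    have c2 : Continuous fun x => ∫ τ in (0:ℝ)..t, u2 x τ :=
      intervalIntegral.continuous_parametric_intervalIntegral_of_continuous' (f := fun x τ => u2 x τ) hu2 0 t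
    rw [intervalIntegral.integral_add (c1.intervalIntegrable _ _) (c2.intervalIntegrable _ _)]
    congr 1
    have : Continuous (Function.uncurry u2) := hu2
    refine intervalIntegral_intervalIntegral_swap ?_
    refine (ContinuousOn.integrableOn_compact (isCompact_uIcc.prod isCompact_uIcc) this.continuousOn).mono_set
      (prod_mono uIoc_subset_uIcc uIoc_subset_uIcc)
  intro t ht
  have := ((hc.integral_hasStrictDerivAt 0 t).hasDerivAt.const_add (∫ x in a..b, u x 0)).hasDerivWithinAt (s := Icc 0 T)
  exact this.congr key (key t ht)

theorem Good.dt (hV : ∀ j, Continuous fun p : ℝ × ℝ => V j p.1 p.2)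
    (hVt : ∀ j, ∃ w, Good V w ∧ ∀ s, ∀ t ∈ Icc (0:ℝ) 1, HasDerivWithinAt (fun t => V j s t) (w s t) (Icc 0 1) t)
    {u : ℝ → ℝ → ℝ} (hu : Good V u) :
    ∃ u1, Good V u1 ∧ ∀ s, ∀ t ∈ Icc (0:ℝ) 1, HasDerivWithinAt (fun t => u s t) (u1 s t) (Icc 0 1) t := by
  induction hu with
  | base j => exact hVt j
  | static g hg => exact ⟨_, Good.const 0, fun s t _ => hasDerivWithinAt_const _ _ _⟩
  | add _ _ h1 h2 =>
    obtain ⟨u1, g1, d1⟩ := h1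
    obtain ⟨w1, g2, d2⟩ := h2
    exact ⟨_, g1.add g2, fun s t ht => (d1 s t ht).add (d2 s t ht)⟩
  | mul k1 k2 h1 h2 =>
    obtain ⟨u1, g1, d1⟩ := h1
    obtain ⟨w1, g2, d2⟩ := h2
    exact ⟨_, (g1.mul k2).add (k1.mul g2), fun s t ht => (d1 s t ht).mul (d2 s t ht)⟩
  | inv k hpos h =>
    obtain ⟨u1, g1, d1⟩ := h
    exact ⟨_, g1.neg.div k.sq (fun s t => pow_pos (hpos s t) 2), fun s t ht => (d1 s t ht).inv (hpos s t).ne'⟩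
  | sqrt k hpos h =>
    obtain ⟨u1, g1, d1⟩ := h
    exact ⟨_, g1.div ((Good.const 2).mul (k.sqrt hpos)) (fun s t => mul_pos two_pos (Real.sqrt_pos.2 (hpos s t))),
      fun s t ht => (d1 s t ht).sqrt (hpos s t).ne'⟩
  | mean k h =>
    obtain ⟨u1, g1, d1⟩ := h
    exact ⟨_, g1.mean, fun s t ht => hasDerivWithinAt_integral zero_le_one 0 (2 * π) (k.continuous hV)
      (g1.continuous hV) d1 t ht⟩

/-- total differentiability from continuous partial derivatives -/
theorem hasFDerivWithinAt_of_partial {u u1 u2 : ℝ → ℝ → ℝ} {I : Set ℝ}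
    (hc : ∀ s, ∀ t ∈ I, ContinuousWithinAt (fun p : ℝ × ℝ => u1 p.1 p.2) (univ ×ˢ I) (s, t))
    (h1 : ∀ s, ∀ t ∈ I, HasDerivAt (fun s => u s t) (u1 s t) s)
    (h2 : ∀ s, ∀ t ∈ I, HasDerivWithinAt (fun t => u s t) (u2 s t) I t) (s t : ℝ) (ht : t ∈ I) :
    HasFDerivWithinAt (fun p : ℝ × ℝ => u p.1 p.2)
      (u1 s t • ContinuousLinearMap.fst ℝ ℝ ℝ + u2 s t • ContinuousLinearMap.snd ℝ ℝ ℝ) (univ ×ˢ I) (s, t) := by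
  rw [hasFDerivWithinAt_iff_isLittleO]
  have k1 : (fun p : ℝ × ℝ => u p.1 p.2 - u s p.2 - u1 s t * (p.1 - s)) =o[nhdsWithin (s, t) (univ ×ˢ I)]
      fun p => p - (s, t) := by
    rw [Asymptotics.isLittleO_iff]
    intro c hc0
    have hcc := Metric.continuousWithinAt_iff.1 (hc s t ht) c hc0
    obtain ⟨δ, hδ, hb⟩ := hcc
    have hball : ∀ᶠ p in nhdsWithin (s, t) (univ ×ˢ I), dist p (s, t) < δ ∧ p.2 ∈ I := by
      filter_upwards [nhdsWithin_le_nhds (Metric.ball_mem_nhds (s, t) hδ), self_mem_nhdsWithin] with p hp1 hp2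
      exact ⟨hp1, hp2.2⟩
    filter_upwards [hball] with p hp
    have hd : dist p.1 s < δ ∧ dist p.2 t < δ := by
      have := hp.1
      rw [Prod.dist_eq, max_lt_iff] at this
      exact this
    have hmv := (convex_ball s δ).norm_image_sub_le_of_norm_hasDerivWithin_le (𝕜 := ℝ)
      (f := fun x => u x p.2 - u1 s t * x) (f' := fun x => u1 x p.2 - u1 s t * 1) (C := c)
      (x := s) (y := p.1)
      (fun x hx => ((h1 x p.2 hp.2).sub ((hasDerivAt_id x).const_mul _)).hasDerivWithinAt)
      (fun x hx => by
        have := hb (x := (x, p.2)) ⟨mem_univ _, hp.2⟩ (by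
          rw [Prod.dist_eq]; exact max_lt hx hd.2)
        rw [dist_eq_norm] at this
        rw [mul_one]; exact this.le)
      (Metric.mem_ball_self hδ) hd.1
    have e : u p.1 p.2 - u s p.2 - u1 s t * (p.1 - s) = u p.1 p.2 - u1 s t * p.1 - (u s p.2 - u1 s t * s) := by ring
    rw [e]
    refine hmv.trans (mul_le_mul_of_nonneg_left ?_ hc0.le)
    exact norm_fst_le (p - (s, t))
  have k2 : (fun p : ℝ × ℝ => u s p.2 - u s t - u2 s t * (p.2 - t)) =o[nhdsWithin (s, t) (univ ×ˢ I)]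
      fun p => p - (s, t) := by
    have h3 := (hasDerivWithinAt_iff_isLittleO.1 (h2 s t ht))
    have ht2 : Tendsto (fun p : ℝ × ℝ => p.2) (nhdsWithin (s, t) (univ ×ˢ I)) (nhdsWithin t I) := by
      refine tendsto_nhdsWithin_iff.2 ⟨(continuous_snd.tendsto (s, t)).mono_left nhdsWithin_le_nhds, ?_⟩
      filter_upwards [self_mem_nhdsWithin] with p hp using hp.2
    have h4 := h3.comp_tendsto ht2
    refine Asymptotics.IsLittleO.trans_isBigO (f := fun p : ℝ × ℝ => u s p.2 - u s t - u2 s t * (p.2 - t)) (g := fun p => p.2 - t) ?_ ?_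
    · refine h4.congr_left fun p => ?_
      simp only [Function.comp, smul_eq_mul]; ring
    · exact Asymptotics.IsBigO.of_bound 1 (Eventually.of_forall fun p => by
        rw [one_mul]; exact norm_snd_le (p - (s, t)))
  refine (k1.add k2).congr_left fun p => ?_
  simp
  ring

theorem Good.contDiffOn (hV : ∀ j, Continuous fun p : ℝ × ℝ => V j p.1 p.2)
    (hVs : ∀ j s t, HasDerivAt (fun s => V j s t) (V (j + 1) s t) s)
    (hVt : ∀ j, ∃ w, Good V w ∧ ∀ s, ∀ t ∈ Icc (0:ℝ) 1, HasDerivWithinAt (fun t => V j s t) (w s t) (Icc 0 1) t)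
    (n : ℕ) : ∀ {u : ℝ → ℝ → ℝ}, Good V u → ContDiffOn ℝ n (fun p : ℝ × ℝ => u p.1 p.2) (univ ×ˢ Icc (0:ℝ) 1) := by
  induction n with
  | zero => intro u hu; exact contDiffOn_zero.2 (hu.continuous hV).continuousOn
  | succ n ih =>
    intro u hu
    obtain ⟨u1, g1, d1⟩ := hu.ds hVs
    obtain ⟨u2, g2, d2⟩ := hu.dt hV hVt
    have hF : ∀ x ∈ (univ ×ˢ Icc (0:ℝ) 1 : Set (ℝ × ℝ)), HasFDerivWithinAt (fun p : ℝ × ℝ => u p.1 p.2)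
      (u1 x.1 x.2 • ContinuousLinearMap.fst ℝ ℝ ℝ + u2 x.1 x.2 • ContinuousLinearMap.snd ℝ ℝ ℝ) (univ ×ˢ Icc (0:ℝ) 1) x := by
      rintro ⟨s, t⟩ hx
      exact hasFDerivWithinAt_of_partial (fun s t _ => (g1.continuous hV).continuousWithinAt)
        (fun s t _ => d1 s t) d2 s t hx.2
    have hsucc : ((n + 1 : ℕ) : WithTop ℕ∞) = (n : WithTop ℕ∞) + 1 := by push_cast; rfl
    rw [hsucc]
    refine contDiffOn_succ_of_fderivWithin (fun x hx => (hF x hx).differentiableWithinAt) (fun h => ?_) ?_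
    · exact absurd h (WithTop.coe_ne_top (a := (n : ℕ∞)))
    have hud : UniqueDiffOn ℝ (univ ×ˢ Icc (0:ℝ) 1 : Set (ℝ × ℝ)) :=
      uniqueDiffOn_univ.prod (uniqueDiffOn_Icc zero_lt_one)
    refine ContDiffOn.congr (f := fun x : ℝ × ℝ => u1 x.1 x.2 • ContinuousLinearMap.fst ℝ ℝ ℝ + u2 x.1 x.2 • ContinuousLinearMap.snd ℝ ℝ ℝ) ?_
      (fun x hx => (hF x hx).fderivWithin (hud x hx))
    exact ((ih g1).smul contDiffOn_const).add ((ih g2).smul contDiffOn_const)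

end GP

namespace GP

theorem Good.of_eq {V : ℕ → ℝ → ℝ → ℝ} {u w : ℝ → ℝ → ℝ} (hu : Good V u) (h : ∀ s t, w s t = u s t) : Good V w := by
  have : w = u := by funext s t; exact h s t
  rw [this]; exact hu

theorem exists_smooth_solution (v0 p : ℝ → ℝ) (hv0 : SP v0) (hp : SP p) (hv0p : ∀ s, 0 < v0 s)
    (hpp : ∀ s, 0 < p s) (a : ℝ) (ha : 0 < a)
    (hpa : ∀ s, p s ^ 2 = a ^ 2 * Ypt (p s) (v0 s) (deriv v0 s)) :
    ∃ (ε : ℝ) (v v1 v2 : ℝ → ℝ → ℝ), 0 < ε ∧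
      ContDiffOn ℝ (⊤ : ℕ∞) (fun q : ℝ × ℝ => v q.1 q.2) (univ ×ˢ Icc (0:ℝ) 1) ∧
      (∀ s, v s 0 = v0 s) ∧ (∀ s t, 0 < v s t) ∧ (∀ t, Function.Periodic (fun s => v s t) (2 * π)) ∧
      (∀ t, Continuous fun s => v1 s t) ∧
      (∀ s t, HasDerivAt (fun s => v s t) (v1 s t) s) ∧ (∀ s t, HasDerivAt (fun s => v1 s t) (v2 s t) s) ∧
      ∀ s, ∀ t ∈ Icc (0:ℝ) 1, HasDerivWithinAt (fun t => v s t)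
        (ε * Rpt (p s) (deriv p s) (v s t) (v1 s t) (v2 s t)
          (∫ u in (0:ℝ)..(2 * π), √(Ypt (p u) (v u t) (v1 u t)) / p u)) (Icc 0 1) t := by
  obtain ⟨W, P, H, ε, hε, hP0, hpos, hPt, hH⟩ := exists_solution v0 p hv0 hp hv0p hpp a ha hpa
  set V : ℕ → ℝ → ℝ → ℝ := fun j s t => Ev P j s t with hVdef
  have hV : ∀ j, Continuous fun q : ℝ × ℝ => V j q.1 q.2 := fun j => continuous_Ev P j
  have hVs : ∀ j s t, HasDerivAt (fun s => V j s t) (V (j + 1) s t) s := fun j s t => hasDerivAt_Ev P j s t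
  have gv : Good V (fun s t => v0 s + Ev P 0 s t) := (Good.static v0 hv0.1).add (Good.base 0)
  have gv1 : Good V (fun s t => deriv v0 s + Ev P 1 s t) := (Good.static _ hv0.deriv.1).add (Good.base 1)
  have gv2 : Good V (fun s t => deriv (deriv v0) s + Ev P 2 s t) :=
    (Good.static _ hv0.deriv.deriv.1).add (Good.base 2)
  have gp : Good V (fun s _ => p s) := Good.static p hp.1
  have gp1 : Good V (fun s _ => deriv p s) := Good.static _ hp.deriv.1
  have gY : Good V (fun s t => Ypt (p s) (v0 s + Ev P 0 s t) (deriv v0 s + Ev P 1 s t)) :=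
    (gv.sq.add (gp.sq.mul gv1.sq)).of_eq fun s t => rfl
  have hY : ∀ s t, 0 < Ypt (p s) (v0 s + Ev P 0 s t) (deriv v0 s + Ev P 1 s t) := fun s t => Ypt_pos (hpos s t)
  have gI : Good V (fun s t => √(Ypt (p s) (v0 s + Ev P 0 s t) (deriv v0 s + Ev P 1 s t)) / p s) :=
    (gY.sqrt hY).div gp (fun s t => hpp s)
  have gm := gI.mean
  have hm : ∀ t, 0 < ∫ u in (0:ℝ)..(2 * π), √(Ypt (p u) (v0 u + Ev P 0 u t) (deriv v0 u + Ev P 1 u t)) / p u := by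
    intro t
    refine intervalIntegral.intervalIntegral_pos_of_pos_on ?_ (fun u _ => div_pos (Real.sqrt_pos.2 (hY u t)) (hpp u)) (by positivity)
    exact ((gI.continuous hV).comp (Continuous.prodMk_left t)).intervalIntegrable _ _
  have gH0 : Good V (fun s t => Ev H 0 s t) := by
    have g1 := ((((gp.sq.mul gv2).add ((gp.mul gp1).mul gv1)).sub
      ((((Good.const 2).mul gp.sq).mul gv1.sq).div gv hpos)).sub gv).div gY hY
    have g2 := ((Good.const (2 * π)).mul (gY.sqrt hY)).div (gv.mul gm) (fun s t => mul_pos (hpos s t) (hm t))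
    refine ((Good.const ε).mul (g1.add g2)).of_eq fun s t => ?_
    rw [hH]; rfl
  have gH : ∀ j, Good V (fun s t => Ev H j s t) := by
    intro j
    induction j with
    | zero => exact gH0
    | succ j ih =>
      obtain ⟨u1, g1, d1⟩ := ih.ds hVs
      exact g1.of_eq fun s t => (hasDerivAt_Ev H j s t).unique (d1 s t)
  have hVt : ∀ j, ∃ w, Good V w ∧ ∀ s, ∀ t ∈ Icc (0:ℝ) 1, HasDerivWithinAt (fun t => V j s t) (w s t) (Icc 0 1) t :=
    fun j => ⟨_, gH j, fun s t ht => hPt j s t ht⟩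
  refine ⟨ε, fun s t => v0 s + Ev P 0 s t, fun s t => deriv v0 s + Ev P 1 s t,
    fun s t => deriv (deriv v0) s + Ev P 2 s t, hε, ?_, ?_, hpos, ?_, ?_, ?_, ?_, ?_⟩
  · exact contDiffOn_infty.2 fun n => gv.contDiffOn hV hVs hVt n
  · intro s; simp [hP0]
  · intro t s
    have h1 := hv0.2 s
    have h2 := Ev_periodic P 0 t s
    simp only at h2 ⊢
    rw [h1, h2]
  · intro t; exact (gv1.continuous hV).comp (Continuous.prodMk_left t)
  · intro s t
    exact ((hv0.differentiable s).hasDerivAt).add (hVs 0 s t)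
  · intro s t
    exact ((hv0.deriv.differentiable s).hasDerivAt).add (hVs 1 s t)
  · intro s t ht
    have := (hPt 0 s t ht).const_add (v0 s)
    rw [hH] at this
    exact this

end GP

namespace GP

/-- a diffeomorphism with prescribed speed -/
theorem exists_diffeo (q : ℝ → ℝ) (hq : SP q) (hqp : ∀ θ, 0 < q θ) (hq2 : ∫ θ in (0:ℝ)..(2 * π), q θ = 2 * π) :
    ∃ S Θ : ℝ → ℝ, ContDiff ℝ (⊤ : ℕ∞) S ∧ ContDiff ℝ (⊤ : ℕ∞) Θ ∧ (∀ θ, HasDerivAt S (q θ) θ) ∧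
      (∀ s, S (Θ s) = s) ∧ (∀ θ, Θ (S θ) = θ) ∧ (∀ θ, S (θ + 2 * π) = S θ + 2 * π) ∧ S 0 = 0 ∧ S (2 * π) = 2 * π := by
  have hqc : Continuous q := hq.1.continuous
  set S : ℝ → ℝ := fun θ => ∫ x in (0:ℝ)..θ, q x with hS
  have hd : ∀ θ, HasDerivAt S (q θ) θ := fun θ => (hqc.integral_hasStrictDerivAt 0 θ).hasDerivAt
  have hSd : Differentiable ℝ S := fun θ => (hd θ).differentiableAt
  have hSs : ContDiff ℝ (⊤ : ℕ∞) S := by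
    rw [contDiff_infty_iff_deriv]
    refine ⟨hSd, ?_⟩
    have : deriv S = q := by funext θ; exact (hd θ).deriv
    rw [this]; exact hq.1
  have hmono : StrictMono S := strictMono_of_deriv_pos fun θ => by rw [(hd θ).deriv]; exact hqp θ
  have hper : ∀ θ, S (θ + 2 * π) = S θ + 2 * π := by
    intro θ
    have h1 := hq.2.intervalIntegral_add_eq 0 θ
    rw [zero_add, hq2] at h1
    simp only [hS]
    rw [← intervalIntegral.integral_add_adjacent_intervals (hqc.intervalIntegrable 0 θ) (hqc.intervalIntegrable θ (θ + 2 * π)), ← h1]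
  have h0 : S 0 = 0 := by simp [hS]
  have hQ : Function.Periodic (fun θ => S θ - θ) (2 * π) := by
    intro θ
    simp only [hper]; ring
  have hsurj : Function.Surjective S := by
    intro y
    have hn : ∀ n : ℤ, S (n * (2 * π)) = n * (2 * π) := by
      intro n
      have := hQ.int_mul n 0
      simp only [zero_add, h0, sub_zero] at this
      linarith
    obtain ⟨n, hn1⟩ := exists_int_gt (y / (2 * π))
    obtain ⟨m, hm1⟩ := exists_int_lt (y / (2 * π))
    have hp : 0 < 2 * π := by positivity
    rw [div_lt_iff₀ hp] at hn1
    rw [lt_div_iff₀ hp] at hm1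
    exact mem_range_of_exists_le_of_exists_ge hSd.continuous ⟨_, (hn m).le.trans hm1.le⟩ ⟨_, hn1.le.trans (hn n).ge⟩
  let e := hmono.orderIsoOfSurjective S hsurj
  refine ⟨S, e.symm, hSs, ?_, hd, fun s => ?_, fun θ => ?_, hper, h0, ?_⟩
  · exact e.toHomeomorph.contDiff_symm_deriv (fun x => (hqp x).ne') hd hSs
  · exact e.apply_symm_apply s
  · exact e.symm_apply_apply θ
  · have := hper 0
    rwa [zero_add, h0, zero_add] at this

theorem radial_exists (r₀ : ℝ → ℝ) (hsmooth : ContDiff ℝ (⊤ : ℕ∞) r₀)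
    (hpos : ∀ θ, 0 < r₀ θ) (hper : Function.Periodic r₀ (2 * π)) :
    ∃ ω > (0:ℝ), ∃ r : ℝ → ℝ → ℝ,
        ContDiffOn ℝ (⊤ : ℕ∞) (fun p : ℝ × ℝ => r p.1 p.2) (Set.univ ×ˢ Set.Ico 0 ω) ∧
          (∀ θ : ℝ, ∀ t ∈ Set.Ico (0:ℝ) ω, 0 < r θ t) ∧
          (∀ t ∈ Set.Ico (0:ℝ) ω, Function.Periodic (fun θ => r θ t) (2 * π)) ∧
          (∀ θ, r θ 0 = r₀ θ) ∧
          RadialGAPF r (Set.Ico 0 ω) := by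
  have hr : SP r₀ := ⟨hsmooth, hper⟩
  set g₀ : ℝ → ℝ := fun θ => √(r₀ θ ^ 2 + deriv r₀ θ ^ 2) with hg₀
  have hYp : ∀ θ, 0 < r₀ θ ^ 2 + deriv r₀ θ ^ 2 := fun θ => by have := hpos θ; positivity
  have hg₀p : ∀ θ, 0 < g₀ θ := fun θ => Real.sqrt_pos.2 (hYp θ)
  have hg₀s : SP g₀ := by
    refine ⟨((hr.1.pow 2).add (hr.deriv.1.pow 2)).sqrt (fun θ => (hYp θ).ne'), fun θ => ?_⟩
    simp only [hg₀]
    rw [hr.2 θ, hr.deriv.2 θ]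
  set L := ∫ θ in (0:ℝ)..(2 * π), g₀ θ with hL
  have hLp : 0 < L := intervalIntegral.intervalIntegral_pos_of_pos_on
    (hg₀s.1.continuous.intervalIntegrable _ _) (fun u _ => hg₀p u) (by positivity)
  set a := 2 * π / L with ha
  have hap : 0 < a := by positivity
  set q : ℝ → ℝ := fun θ => a * g₀ θ with hq
  have hqs : SP q := ⟨contDiff_const.mul hg₀s.1, fun θ => by simp only [hq]; rw [hg₀s.2 θ]⟩
  have hqp : ∀ θ, 0 < q θ := fun θ => mul_pos hap (hg₀p θ)
  obtain ⟨S, Θ, hS, hΘ, hSd, hSΘ, hΘS, hSper, hS0, hS2⟩ := exists_diffeo q hqs hqp (by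
    rw [hq, intervalIntegral.integral_const_mul, ← hL, ha]; field_simp)
  have hΘper : ∀ s, Θ (s + 2 * π) = Θ s + 2 * π := by
    intro s
    rw [← hΘS (Θ s + 2 * π), hSper, hSΘ]
  have hΘd : ∀ s, HasDerivAt Θ (q (Θ s))⁻¹ s := fun s =>
    HasDerivAt.of_local_left_inverse hΘ.continuous.continuousAt (hSd (Θ s)) (hqp _).ne' (Eventually.of_forall hSΘ)
  set v0 : ℝ → ℝ := fun s => r₀ (Θ s) with hv0
  set p : ℝ → ℝ := fun s => q (Θ s) with hp
  have hv0s : SP v0 := ⟨hr.1.comp hΘ, fun s => by simp only [hv0]; rw [hΘper, hr.2]⟩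
  have hps : SP p := ⟨hqs.1.comp hΘ, fun s => by simp only [hp]; rw [hΘper, hqs.2]⟩
  have hpS : ∀ θ, p (S θ) = q θ := fun θ => by simp only [hp]; rw [hΘS]
  have hpa : ∀ s, p s ^ 2 = a ^ 2 * Ypt (p s) (v0 s) (deriv v0 s) := by
    intro s
    have h1 : deriv v0 s = deriv r₀ (Θ s) * (q (Θ s))⁻¹ :=
      (HasDerivAt.comp s (hr.differentiable (Θ s)).hasDerivAt (hΘd s)).deriv
    have h2 : Ypt (p s) (v0 s) (deriv v0 s) = r₀ (Θ s) ^ 2 + deriv r₀ (Θ s) ^ 2 := by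
      rw [h1, Ypt]
      simp only [hp, hv0]
      have := (hqp (Θ s)).ne'
      field_simp
    rw [h2]
    simp only [hp, hq, hg₀]
    rw [mul_pow, Real.sq_sqrt (hYp _).le]
  obtain ⟨ε, v, v1, v2, hε, hvs, hvi, hvp, hvper, hv1c, hv1, hv2, hvt⟩ :=
    exists_smooth_solution v0 p hv0s hps (fun s => hpos _) (fun s => hqp _) a hap hpa
  have hmaps : ∀ t ∈ Ico (0:ℝ) ε, t / ε ∈ Icc (0:ℝ) 1 := fun t ht =>
    ⟨div_nonneg ht.1 hε.le, (div_le_one hε).2 ht.2.le⟩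
  set r : ℝ → ℝ → ℝ := fun θ t => v (S θ) (t / ε) with hrdef
  have hrd : ∀ t, deriv (fun u => r u t) = fun θ => v1 (S θ) (t / ε) * p (S θ) := by
    intro t; funext θ
    have := HasDerivAt.comp θ (hv1 (S θ) (t / ε)) (hSd θ)
    rw [← hpS] at this
    exact this.deriv
  have hrd1 : ∀ θ t, rdθ r θ t = v1 (S θ) (t / ε) * p (S θ) := fun θ t => by
    rw [rdθ, hrd]
  have hrd2 : ∀ θ t, rdθθ r θ t = v2 (S θ) (t / ε) * p (S θ) * p (S θ) + v1 (S θ) (t / ε) * (deriv p (S θ) * p (S θ)) := by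
    intro θ t
    rw [rdθθ, hrd]
    have k1 := HasDerivAt.comp θ (hv2 (S θ) (t / ε)) (hSd θ)
    have k2 := HasDerivAt.comp θ (hps.differentiable (S θ)).hasDerivAt (hSd θ)
    rw [← hpS] at k1 k2
    exact (k1.mul k2).deriv
  have hmet : ∀ θ t, rmet r θ t = √(Ypt (p (S θ)) (v (S θ) (t / ε)) (v1 (S θ) (t / ε))) := by
    intro θ t
    rw [rmet, hrd1, Ypt]
    congr 1
    simp only [hrdef]; ring
  have hlen : ∀ t, rlen r t = ∫ u in (0:ℝ)..(2 * π), √(Ypt (p u) (v u (t / ε)) (v1 u (t / ε))) / p u := by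
    intro t
    have hvc : Continuous fun u => v u (t / ε) := by
      exact continuous_iff_continuousAt.2 fun u => (hv1 u (t / ε)).continuousAt
    have hc : Continuous fun u => √(Ypt (p u) (v u (t / ε)) (v1 u (t / ε))) / p u := by
      refine Continuous.div ?_ hps.1.continuous (fun u => (hqp _).ne')
      simp only [Ypt]
      exact ((hvc.pow 2).add ((hps.1.continuous.pow 2).mul ((hv1c _).pow 2))).sqrt
    have := intervalIntegral.integral_comp_mul_deriv (a := 0) (b := 2 * π) (f := S) (f' := q)
      (g := fun u => √(Ypt (p u) (v u (t / ε)) (v1 u (t / ε))) / p u) (fun x _ => hSd x) hqs.1.continuous.continuousOn hc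
    rw [hS0, hS2] at this
    rw [← this, rlen]
    congr 1; funext θ
    rw [hmet, Function.comp, hpS]
    have := (hqp θ).ne'
    field_simp
  refine ⟨ε, hε, r, ?_, fun θ t _ => hvp _ _, fun t _ θ => ?_, fun θ => ?_, fun t ht θ => ?_⟩
  · refine ContDiffOn.comp hvs (f := fun q : ℝ × ℝ => (S q.1, q.2 / ε)) ?_ (fun x hx => ⟨mem_univ _, hmaps _ hx.2⟩)
    exact ((hS.comp contDiff_fst).prodMk (contDiff_snd.div_const ε)).contDiffOn
  · simp only [hrdef]
    rw [hSper]; exact hvper _ _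
  · simp only [hrdef]
    rw [zero_div, hvi]
    simp only [hv0, hΘS]
  · have h1 := hvt (S θ) (t / ε) (hmaps t ht)
    have h2 : HasDerivWithinAt (fun t : ℝ => t / ε) (1 / ε) (Ico 0 ε) t := ((hasDerivAt_id t).div_const ε).hasDerivWithinAt
    have h3 := h1.scomp t h2 (fun t ht => hmaps t ht)
    refine h3.congr_deriv ?_
    rw [← hlen t, hmet, hrd1, hrd2, Real.sq_sqrt (Ypt_pos (hvp _ _)).le]
    simp only [hrdef, Rpt]
    have e1 := (Ypt_pos (p := p (S θ)) (vs := v1 (S θ) (t / ε)) (hvp (S θ) (t / ε))).ne'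
    have e2 := (hvp (S θ) (t / ε)).ne'
    generalize Ypt (p (S θ)) (v (S θ) (t / ε)) (v1 (S θ) (t / ε)) = Y at *
    rw [smul_eq_mul, ← mul_assoc, one_div, inv_mul_cancel₀ hε.ne', one_mul]
    congr 1
    field_simp

end GP

namespace GP

theorem integral_sq_le {f : ℝ → ℝ} (hf : Continuous f) :
    (∫ x in (0:ℝ)..(2 * π), f x) ^ 2 ≤ 2 * π * ∫ x in (0:ℝ)..(2 * π), f x ^ 2 := by
  have hp : 0 < 2 * π := by positivity
  set m := (∫ x in (0:ℝ)..(2 * π), f x) with hm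
  have h0 : 0 ≤ ∫ x in (0:ℝ)..(2 * π), (2 * π * f x - m) ^ 2 :=
    intervalIntegral.integral_nonneg hp.le fun x _ => sq_nonneg _
  have h1 : ∀ x, (2 * π * f x - m) ^ 2 = (2 * π) ^ 2 * f x ^ 2 - (2 * (2 * π) * m) * f x + m ^ 2 := fun x => by ring
  have i1 : IntervalIntegrable (fun x => (2 * π) ^ 2 * f x ^ 2) volume 0 (2 * π) :=
    (continuous_const.mul (hf.pow 2)).intervalIntegrable _ _
  have i2 : IntervalIntegrable (fun x => (2 * (2 * π) * m) * f x) volume 0 (2 * π) :=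
    (continuous_const.mul hf).intervalIntegrable _ _
  have i3 : IntervalIntegrable (fun _ : ℝ => m ^ 2) volume 0 (2 * π) := continuous_const.intervalIntegrable _ _
  simp_rw [h1] at h0
  rw [intervalIntegral.integral_add (i1.sub i2) i3, intervalIntegral.integral_sub i1 i2,
    intervalIntegral.integral_const_mul, intervalIntegral.integral_const_mul, intervalIntegral.integral_const, ← hm,
    smul_eq_mul, sub_zero] at h0
  have h2 : 0 ≤ 2 * π * (2 * π * (∫ x in (0:ℝ)..(2 * π), f x ^ 2) - m ^ 2) := by linarith
  have := nonneg_of_mul_nonneg_right h2 hp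
  linarith

theorem energy_pointwise {A A1 w w1 w2 wt C M c0 J δ : ℝ} (hc0 : 0 < c0) (hδ : 0 < δ) (hC : 0 ≤ C)
    (hA : c0 ≤ A) (hA1 : |A1| ≤ M) (h : |wt - A * w2| ≤ C * (|w| + |w1| + J)) (hJ : 0 ≤ J) :
    2 * w * wt ≤ 2 * ((A1 * w + A * w1) * w1 + A * w * w2) - c0 * w1 ^ 2
      + ((M + C) ^ 2 / c0 + 2 * C + C ^ 2 / δ) * w ^ 2 + δ * J ^ 2 := by
  have hM : 0 ≤ M := (abs_nonneg _).trans hA1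
  have k1 : w * (wt - A * w2) ≤ |w| * (C * (|w| + |w1| + J)) :=
    (le_abs_self _).trans (by rw [abs_mul]; exact mul_le_mul_of_nonneg_left h (abs_nonneg _))
  have k2 : -(A1 * w * w1) ≤ M * |w| * |w1| := by
    refine (neg_le_abs _).trans ?_
    rw [abs_mul, abs_mul]
    gcongr
  have k3 : c0 * w1 ^ 2 ≤ A * w1 ^ 2 := mul_le_mul_of_nonneg_right hA (sq_nonneg _)
  have k4 : 2 * (M + C) * (|w| * |w1|) ≤ c0 * w1 ^ 2 + (M + C) ^ 2 / c0 * w ^ 2 := by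
    have : 0 ≤ (c0 * |w1| - (M + C) * |w|) ^ 2 / c0 := by positivity
    have e : (c0 * |w1| - (M + C) * |w|) ^ 2 / c0 = c0 * |w1| ^ 2 + (M + C) ^ 2 / c0 * |w| ^ 2 - 2 * (M + C) * (|w| * |w1|) := by
      field_simp; ring
    rw [e, sq_abs, sq_abs] at this
    linarith
  have k5 : 2 * C * (|w| * J) ≤ δ * J ^ 2 + C ^ 2 / δ * w ^ 2 := by
    have : 0 ≤ (δ * J - C * |w|) ^ 2 / δ := by positivity
    have e : (δ * J - C * |w|) ^ 2 / δ = δ * J ^ 2 + C ^ 2 / δ * |w| ^ 2 - 2 * C * (|w| * J) := by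
      field_simp; ring
    rw [e, sq_abs] at this
    linarith
  have k6 : |w| * |w| = w ^ 2 := by rw [← sq, sq_abs]
  nlinarith [k1, k2, k3, k4, k5, k6]

theorem energy_zero {T : ℝ} (hT : 0 < T) (w w1 w2 wt A A1 : ℝ → ℝ → ℝ)
    (cw : Continuous fun p : ℝ × ℝ => w p.1 p.2) (cw1 : Continuous fun p : ℝ × ℝ => w1 p.1 p.2)
    (cw2 : Continuous fun p : ℝ × ℝ => w2 p.1 p.2) (cwt : Continuous fun p : ℝ × ℝ => wt p.1 p.2)
    (cA : Continuous fun p : ℝ × ℝ => A p.1 p.2) (cA1 : Continuous fun p : ℝ × ℝ => A1 p.1 p.2)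
    (dw : ∀ x, ∀ t ∈ Icc (0:ℝ) T, HasDerivAt (fun x => w x t) (w1 x t) x)
    (dw1 : ∀ x, ∀ t ∈ Icc (0:ℝ) T, HasDerivAt (fun x => w1 x t) (w2 x t) x)
    (dA : ∀ x, ∀ t ∈ Icc (0:ℝ) T, HasDerivAt (fun x => A x t) (A1 x t) x)
    (dt : ∀ x, ∀ t ∈ Icc (0:ℝ) T, HasDerivWithinAt (fun t => w x t) (wt x t) (Icc 0 T) t)
    (pw : ∀ t ∈ Icc (0:ℝ) T, w (2 * π) t = w 0 t) (pw1 : ∀ t ∈ Icc (0:ℝ) T, w1 (2 * π) t = w1 0 t)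
    (pA : ∀ t ∈ Icc (0:ℝ) T, A (2 * π) t = A 0 t)
    {c0 C M : ℝ} (hc0 : 0 < c0) (hC : 0 ≤ C)
    (hA : ∀ x ∈ Icc 0 (2 * π), ∀ t ∈ Icc (0:ℝ) T, c0 ≤ A x t)
    (hA1 : ∀ x ∈ Icc 0 (2 * π), ∀ t ∈ Icc (0:ℝ) T, |A1 x t| ≤ M)
    (h : ∀ x ∈ Icc 0 (2 * π), ∀ t ∈ Icc (0:ℝ) T, |wt x t - A x t * w2 x t| ≤
      C * (|w x t| + |w1 x t| + ∫ x in (0:ℝ)..(2 * π), (|w x t| + |w1 x t|)))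
    (hw0 : ∀ x, w x 0 = 0) : ∀ x ∈ Icc 0 (2 * π), ∀ t ∈ Icc (0:ℝ) T, w x t = 0 := by
  have hp : 0 < 2 * π := by positivity
  set δ := c0 / (8 * π ^ 2) with hδ
  have hδp : 0 < δ := by positivity
  set K1 := (M + C) ^ 2 / c0 + 2 * C + C ^ 2 / δ with hK1
  set E : ℝ → ℝ := fun t => ∫ x in (0:ℝ)..(2 * π), w x t ^ 2 with hE
  have sec : ∀ {u : ℝ → ℝ → ℝ}, (Continuous fun p : ℝ × ℝ => u p.1 p.2) → ∀ t, Continuous fun x => u x t :=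
    fun hu t => hu.comp (Continuous.prodMk_left t)
  have hEd : ∀ t ∈ Icc (0:ℝ) T, HasDerivWithinAt E (∫ x in (0:ℝ)..(2 * π), 2 * w x t * wt x t) (Icc 0 T) t := by
    refine hasDerivWithinAt_integral (u := fun x t => w x t ^ 2) (u2 := fun x t => 2 * w x t * wt x t) hT.le 0 (2 * π)
      (cw.pow 2) ((continuous_const.mul cw).mul cwt) (fun x t ht => ?_)
    have := ((dt x t ht).pow 2).congr_deriv (g' := 2 * w x t * wt x t) (by simp)
    exact this
  have hmain : ∀ t ∈ Icc (0:ℝ) T, (∫ x in (0:ℝ)..(2 * π), 2 * w x t * wt x t) ≤ (K1 + c0) * E t := by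
    intro t ht
    set J := ∫ x in (0:ℝ)..(2 * π), (|w x t| + |w1 x t|) with hJ
    have hJ0 : 0 ≤ J := intervalIntegral.integral_nonneg hp.le fun x _ => by positivity
    have hwc := sec cw t
    have hw1c := sec cw1 t
    have hw2c := sec cw2 t
    have hwtc := sec cwt t
    have hAc := sec cA t
    have hA1c := sec cA1 t
    set F := ∫ x in (0:ℝ)..(2 * π), w1 x t ^ 2 with hF
    have hJE : J ^ 2 ≤ 4 * π * (E t + F) := by
      refine (integral_sq_le (f := fun x => |w x t| + |w1 x t|) (hwc.abs.add hw1c.abs)).trans ?_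
      have l1 : IntervalIntegrable (fun x => 2 * w x t ^ 2) volume 0 (2 * π) :=
        (continuous_const.mul (hwc.pow 2)).intervalIntegrable _ _
      have l2 : IntervalIntegrable (fun x => 2 * w1 x t ^ 2) volume 0 (2 * π) :=
        (continuous_const.mul (hw1c.pow 2)).intervalIntegrable _ _
      have : ∫ x in (0:ℝ)..(2 * π), (|w x t| + |w1 x t|) ^ 2 ≤ ∫ x in (0:ℝ)..(2 * π), (2 * w x t ^ 2 + 2 * w1 x t ^ 2) := by
        refine intervalIntegral.integral_mono_on hp.le (((hwc.abs.add hw1c.abs).pow 2).intervalIntegrable _ _)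
          (l1.add l2) fun x _ => ?_
        nlinarith [sq_abs (w x t), sq_abs (w1 x t), sq_nonneg (|w x t| - |w1 x t|)]
      rw [intervalIntegral.integral_add l1 l2,
        intervalIntegral.integral_const_mul, intervalIntegral.integral_const_mul] at this
      calc 2 * π * ∫ x in (0:ℝ)..(2 * π), (|w x t| + |w1 x t|) ^ 2 ≤ 2 * π * (2 * E t + 2 * F) :=
            mul_le_mul_of_nonneg_left this hp.le
        _ = _ := by ring
    set G : ℝ → ℝ := fun x => (A1 x t * w x t + A x t * w1 x t) * w1 x t + A x t * w x t * w2 x t with hG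
    have hGc : Continuous G := (((hA1c.mul hwc).add (hAc.mul hw1c)).mul hw1c).add ((hAc.mul hwc).mul hw2c)
    have hG0 : ∫ x in (0:ℝ)..(2 * π), G x = 0 := by
      rw [intervalIntegral.integral_eq_sub_of_hasDerivAt (f := fun x => A x t * w x t * w1 x t) (f' := G)
        (fun x _ => ((dA x t ht).mul (dw x t ht)).mul (dw1 x t ht)) (hGc.intervalIntegrable _ _)]
      rw [pA t ht, pw t ht, pw1 t ht, sub_self]
    have j1 : IntervalIntegrable (fun x => 2 * G x) volume 0 (2 * π) := (continuous_const.mul hGc).intervalIntegrable _ _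
    have j2 : IntervalIntegrable (fun x => c0 * w1 x t ^ 2) volume 0 (2 * π) :=
      (continuous_const.mul (hw1c.pow 2)).intervalIntegrable _ _
    have j3 : IntervalIntegrable (fun x => K1 * w x t ^ 2) volume 0 (2 * π) :=
      (continuous_const.mul (hwc.pow 2)).intervalIntegrable _ _
    have j4 : IntervalIntegrable (fun _ : ℝ => δ * J ^ 2) volume 0 (2 * π) := continuous_const.intervalIntegrable _ _
    have hle : ∫ x in (0:ℝ)..(2 * π), 2 * w x t * wt x t ≤
        ∫ x in (0:ℝ)..(2 * π), (2 * G x - c0 * w1 x t ^ 2 + K1 * w x t ^ 2 + δ * J ^ 2) := by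
      refine intervalIntegral.integral_mono_on hp.le
        (((continuous_const.mul hwc).mul hwtc).intervalIntegrable _ _) (((j1.sub j2).add j3).add j4) fun x hx => ?_
      exact energy_pointwise hc0 hδp hC (hA x hx t ht) (hA1 x hx t ht) (h x hx t ht) hJ0
    rw [intervalIntegral.integral_add ((j1.sub j2).add j3) j4, intervalIntegral.integral_add (j1.sub j2) j3,
      intervalIntegral.integral_sub j1 j2, intervalIntegral.integral_const_mul, intervalIntegral.integral_const_mul,
      intervalIntegral.integral_const_mul, intervalIntegral.integral_const, hG0, smul_eq_mul, sub_zero] at hle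
    have hfin : 2 * π * (δ * J ^ 2) ≤ c0 * (E t + F) := by
      calc 2 * π * (δ * J ^ 2) ≤ 2 * π * (δ * (4 * π * (E t + F))) := by gcongr
        _ = _ := by rw [hδ]; field_simp; ring
    have : (∫ x in (0:ℝ)..(2 * π), w x t ^ 2) = E t := rfl
    rw [this] at hle
    linarith
  have hE0 : E 0 = 0 := by simp [hE, hw0]
  have hEz : ∀ t ∈ Icc (0:ℝ) T, E t ≤ 0 := by
    set k := K1 + c0
    have hd : ∀ t ∈ Icc (0:ℝ) T, HasDerivWithinAt (fun t => Real.exp (-k * t) * E t)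
        (Real.exp (-k * t) * (-k * 1) * E t + Real.exp (-k * t) * (∫ x in (0:ℝ)..(2 * π), 2 * w x t * wt x t)) (Icc 0 T) t := by
      intro t ht
      exact ((((hasDerivAt_id t).const_mul (-k)).exp).hasDerivWithinAt).mul (hEd t ht)
    have hanti : AntitoneOn (fun t => Real.exp (-k * t) * E t) (Icc 0 T) := by
      refine antitoneOn_of_hasDerivWithinAt_nonpos (convex_Icc 0 T) (fun t ht => (hd t ht).continuousWithinAt)
        (fun t ht => (hd t (interior_subset ht)).mono interior_subset) (fun t ht => ?_)
      have := hmain t (interior_subset ht)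
      have e := Real.exp_pos (-k * t)
      nlinarith
    intro t ht
    have := hanti (left_mem_Icc.2 hT.le) ht ht.1
    simp only [hE0, mul_zero] at this
    exact nonpos_of_mul_nonpos_right this (Real.exp_pos _)
  intro x hx t ht
  have hwc := sec cw t
  by_contra hne
  have hpos : 0 < E t := by
    refine intervalIntegral.integral_pos hp (hwc.pow 2).continuousOn (fun x _ => sq_nonneg _) ⟨x, hx, by positivity⟩
  exact absurd (hEz t ht) (not_le.2 hpos)

end GP

namespace GP

theorem partial_smooth {f : ℝ → ℝ → ℝ} {I : Set ℝ} (hI : UniqueDiffOn ℝ I)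
    (hf : ContDiffOn ℝ (⊤ : ℕ∞) (fun p : ℝ × ℝ => f p.1 p.2) (univ ×ˢ I)) :
    ContDiffOn ℝ (⊤ : ℕ∞) (fun p : ℝ × ℝ => deriv (fun u => f u p.2) p.1) (univ ×ˢ I) ∧
    ∀ θ, ∀ t ∈ I, HasDerivAt (fun u => f u t) (deriv (fun u => f u t) θ) θ := by
  have hud : UniqueDiffOn ℝ (univ ×ˢ I : Set (ℝ × ℝ)) := uniqueDiffOn_univ.prod hI
  have key : ∀ θ, ∀ t ∈ I, HasDerivAt (fun u => f u t)
      (fderivWithin ℝ (fun p : ℝ × ℝ => f p.1 p.2) (univ ×ˢ I) (θ, t) (1, 0)) θ := by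
    intro θ t ht
    have h1 := ((hf.differentiableOn (by simp)) (θ, t) ⟨mem_univ _, ht⟩).hasFDerivWithinAt
    have h2 : HasDerivWithinAt (fun u : ℝ => (u, t)) ((1:ℝ), (0:ℝ)) univ θ :=
      ((hasDerivAt_id θ).prodMk (hasDerivAt_const θ t)).hasDerivWithinAt
    have h3 := h1.comp_hasDerivWithinAt θ h2 (fun u _ => mk_mem_prod (mem_univ u) ht)
    exact hasDerivWithinAt_univ.1 h3
  refine ⟨?_, fun θ t ht => (key θ t ht).differentiableAt.hasDerivAt⟩
  have h4 : ContDiffOn ℝ (⊤ : ℕ∞) (fderivWithin ℝ (fun p : ℝ × ℝ => f p.1 p.2) (univ ×ˢ I)) (univ ×ˢ I) :=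
    hf.fderivWithin hud (by simp)
  refine (h4.clm_apply (contDiffOn_const (c := ((1:ℝ), (0:ℝ))))).congr fun p hp => ?_
  exact (key p.1 p.2 hp.2).deriv

/-- right-hand side -/
def GG (u q A L : ℝ) : ℝ :=
  A / (u ^ 2 + q ^ 2) - 2 * q ^ 2 / (u * (u ^ 2 + q ^ 2)) - u / (u ^ 2 + q ^ 2) + 2 * π * √(u ^ 2 + q ^ 2) / (u * L)

theorem sol_data {r : ℝ → ℝ → ℝ} {ω T : ℝ} (hT : 0 < T) (hTω : T < ω)
    (h1 : ContDiffOn ℝ (⊤ : ℕ∞) (fun p : ℝ × ℝ => r p.1 p.2) (Set.univ ×ˢ Set.Ico 0 ω))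
    (h2 : ∀ θ : ℝ, ∀ t ∈ Set.Ico (0:ℝ) ω, 0 < r θ t)
    (h3 : ∀ t ∈ Set.Ico (0:ℝ) ω, Function.Periodic (fun θ => r θ t) (2 * π))
    (h4 : RadialGAPF r (Set.Ico 0 ω)) :
    ∃ u u1 u2 : ℝ → ℝ → ℝ, ∃ L : ℝ → ℝ, (Continuous fun p : ℝ × ℝ => u p.1 p.2) ∧ (Continuous fun p : ℝ × ℝ => u1 p.1 p.2) ∧
      (Continuous fun p : ℝ × ℝ => u2 p.1 p.2) ∧ Continuous L ∧
      (∀ x, ∀ t ∈ Icc 0 T, u x t = r x t) ∧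
      (∀ x t, HasDerivAt (fun x => u x t) (u1 x t) x) ∧
      (∀ x t, HasDerivAt (fun x => u1 x t) (u2 x t) x) ∧ (∀ x t, 0 < u x t) ∧ (∀ t, 0 < L t) ∧
      (∀ t, L t = ∫ x in (0:ℝ)..(2 * π), √(u x t ^ 2 + u1 x t ^ 2)) ∧
      (∀ t, u (2 * π) t = u 0 t) ∧ (∀ t, u1 (2 * π) t = u1 0 t) ∧
      ∀ x, ∀ t ∈ Icc 0 T, HasDerivWithinAt (fun t => u x t) (GG (u x t) (u1 x t) (u2 x t) (L t)) (Icc 0 T) t := by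
  set τ : ℝ → ℝ := fun t => max 0 (min t T) with hτ
  have hτc : Continuous τ := continuous_const.max (continuous_id.min continuous_const)
  have hτm : ∀ t, τ t ∈ Ico (0:ℝ) ω := fun t => ⟨le_max_left _ _, (max_le hT.le (min_le_right _ _)).trans_lt hTω⟩
  have hτe : ∀ t ∈ Icc (0:ℝ) T, τ t = t := fun t ht => by
    simp only [hτ]; rw [min_eq_left ht.2, max_eq_right ht.1]
  have hω : 0 < ω := hT.trans hTω
  have hI : UniqueDiffOn ℝ (Ico (0:ℝ) ω) := uniqueDiffOn_Ico 0 ω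
  obtain ⟨p1, d1⟩ := partial_smooth hI h1
  obtain ⟨p2, d2⟩ := partial_smooth (f := rdθ r) hI p1
  have cl : ∀ {f : ℝ → ℝ → ℝ}, ContDiffOn ℝ (⊤ : ℕ∞) (fun p : ℝ × ℝ => f p.1 p.2) (Set.univ ×ˢ Set.Ico 0 ω) →
      Continuous fun p : ℝ × ℝ => f p.1 (τ p.2) := by
    intro f hf
    exact hf.continuousOn.comp_continuous (f := fun p : ℝ × ℝ => (p.1, τ p.2))
      (continuous_fst.prodMk (hτc.comp continuous_snd)) (fun p => ⟨mem_univ _, hτm _⟩)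
  have cu := cl h1
  have cu1 := cl (f := rdθ r) p1
  have cu2 := cl (f := rdθθ r) p2
  have hup : ∀ x t, 0 < r x (τ t) := fun x t => h2 x _ (hτm t)
  have hYc : Continuous fun p : ℝ × ℝ => √(r p.1 (τ p.2) ^ 2 + rdθ r p.1 (τ p.2) ^ 2) := ((cu.pow 2).add (cu1.pow 2)).sqrt
  have hLc := continuous_integral_param (u := fun x t => √(r x (τ t) ^ 2 + rdθ r x (τ t) ^ 2)) hYc 0 (2 * π)
  refine ⟨fun x t => r x (τ t), fun x t => rdθ r x (τ t), fun x t => rdθθ r x (τ t), _, cu, cu1, cu2, hLc, ?_, ?_, ?_,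
    hup, ?_, fun t => rfl, ?_, ?_, ?_⟩
  · intro x t ht
    simp only [hτe t ht]
  · intro x t; exact d1 x _ (hτm t)
  · intro x t; exact d2 x _ (hτm t)
  · intro t
    refine intervalIntegral.intervalIntegral_pos_of_pos_on ((hYc.comp (Continuous.prodMk_left t)).intervalIntegrable _ _)
      (fun x _ => Real.sqrt_pos.2 ?_) (by positivity)
    have := hup x t
    positivity
  · intro t
    have := h3 _ (hτm t) 0
    rwa [zero_add] at this
  · intro t
    have hp : Function.Periodic (deriv fun θ => r θ (τ t)) (2 * π) := by
      intro x
      have e : (fun θ => r (θ + 2 * π) (τ t)) = fun θ => r θ (τ t) := funext fun θ => h3 _ (hτm t) θ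
      rw [← deriv_comp_add_const, e]
    have := hp 0
    rwa [zero_add] at this
  · intro x t ht
    have hsub : Icc (0:ℝ) T ⊆ Ico 0 ω := fun t ht => ⟨ht.1, ht.2.trans_lt hTω⟩
    have k := (h4 t (hsub ht) x).mono hsub
    have k2 : HasDerivWithinAt (fun t => r x (τ t)) _ (Icc 0 T) t :=
      k.congr (fun y hy => by simp only [hτe y hy]) (by simp only [hτe t ht])
    refine k2.congr_deriv ?_
    simp only [hτe t ht]
    have hr := h2 x t (hsub ht)
    have hY : 0 < r x t ^ 2 + rdθ r x t ^ 2 := by positivity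
    rw [GG, rlen]
    simp only [rmet]
    rw [Real.sq_sqrt hY.le]
    congr 3
    field_simp

theorem sqrt_diff_le (a b c d : ℝ) : |√(a ^ 2 + b ^ 2) - √(c ^ 2 + d ^ 2)| ≤ |a - c| + |b - d| := by
  have key : ∀ a b c d : ℝ, √(a ^ 2 + b ^ 2) ≤ √(c ^ 2 + d ^ 2) + (|a - c| + |b - d|) := by
    intro a b c d
    have hc : |c| ≤ √(c ^ 2 + d ^ 2) := Real.abs_le_sqrt (by nlinarith [sq_nonneg d])
    have hd : |d| ≤ √(c ^ 2 + d ^ 2) := Real.abs_le_sqrt (by nlinarith [sq_nonneg c])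
    have hs : √(c ^ 2 + d ^ 2) ^ 2 = c ^ 2 + d ^ 2 := Real.sq_sqrt (by positivity)
    have hs0 := Real.sqrt_nonneg (c ^ 2 + d ^ 2)
    generalize √(c ^ 2 + d ^ 2) = s at *
    refine Real.sqrt_le_iff.2 ⟨by positivity, ?_⟩
    have e1 : a ^ 2 ≤ c ^ 2 + 2 * (s * |a - c|) + |a - c| ^ 2 := by
      rw [sq_abs]
      have : c * (a - c) ≤ s * |a - c| := (le_abs_self _).trans (by rw [abs_mul]; gcongr)
      nlinarith
    have e2 : b ^ 2 ≤ d ^ 2 + 2 * (s * |b - d|) + |b - d| ^ 2 := by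
      rw [sq_abs]
      have : d * (b - d) ≤ s * |b - d| := (le_abs_self _).trans (by rw [abs_mul]; gcongr)
      nlinarith
    have : 0 ≤ |a - c| * |b - d| := by positivity
    nlinarith
  rw [abs_le]
  have h1 := key a b c d
  have h2 := key c d a b
  rw [abs_sub_comm c a, abs_sub_comm d b] at h2
  constructor <;> linarith

theorem exists_lower {f : ℝ → ℝ → ℝ} (hf : Continuous fun p : ℝ × ℝ => f p.1 p.2) (hp : ∀ x t, 0 < f x t) (T : ℝ) :
    ∃ m > 0, ∀ x ∈ Icc (0:ℝ) (2 * π), ∀ t ∈ Icc (0:ℝ) T, m ≤ f x t := by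
  obtain ⟨m, hm, h⟩ := (isCompact_Icc (a := (0:ℝ)) (b := 2 * π)).prod (isCompact_Icc (a := (0:ℝ)) (b := T)) |>.exists_forall_le'
    hf.continuousOn (a := 0) (fun p _ => hp p.1 p.2)
  exact ⟨m, hm, fun x hx t ht => h (x, t) ⟨hx, ht⟩⟩

theorem exists_upper {f : ℝ → ℝ → ℝ} (hf : Continuous fun p : ℝ × ℝ => f p.1 p.2) (T : ℝ) :
    ∃ M, ∀ x ∈ Icc (0:ℝ) (2 * π), ∀ t ∈ Icc (0:ℝ) T, |f x t| ≤ M := by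
  obtain ⟨M, h⟩ := (isCompact_Icc (a := (0:ℝ)) (b := 2 * π)).prod (isCompact_Icc (a := (0:ℝ)) (b := T)) |>.exists_bound_of_continuousOn
    hf.continuousOn
  exact ⟨M, fun x hx t ht => h (x, t) ⟨hx, ht⟩⟩

theorem GG_lipschitz {m M : ℝ} (hm : 0 < m) : ∃ C ≥ 0, ∀ u q A L u' q' A' L' : ℝ,
    u ∈ Icc m M → u' ∈ Icc m M → L ∈ Icc m M → L' ∈ Icc m M → q ∈ Icc (-M) M → q' ∈ Icc (-M) M →
    A ∈ Icc (-M) M → A' ∈ Icc (-M) M →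
    |GG u q A L - GG u' q' A' L'| ≤ C * (|u - u'| + |q - q'| + |A - A'| + |L - L'|) := by
  set K : Set (ℝ × ℝ × ℝ × ℝ) := Icc m M ×ˢ Icc (-M) M ×ˢ Icc (-M) M ×ˢ Icc m M with hK
  have hcomp : IsCompact K := isCompact_Icc.prod (isCompact_Icc.prod (isCompact_Icc.prod isCompact_Icc))
  have hconv : Convex ℝ K := (convex_Icc _ _).prod ((convex_Icc _ _).prod ((convex_Icc _ _).prod (convex_Icc _ _)))
  have hsm : ContDiffOn ℝ 1 (fun z : ℝ × ℝ × ℝ × ℝ => GG z.1 z.2.1 z.2.2.1 z.2.2.2) K := by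
    intro z hz
    have hu : 0 < z.1 := hm.trans_le hz.1.1
    have hL : 0 < z.2.2.2 := hm.trans_le hz.2.2.2.1
    have hY : 0 < z.1 ^ 2 + z.2.1 ^ 2 := by positivity
    refine ContDiffAt.contDiffWithinAt ?_
    unfold GG
    have f1 : ContDiffAt ℝ 1 (fun z : ℝ × ℝ × ℝ × ℝ => z.1) z := contDiffAt_fst
    have f2 : ContDiffAt ℝ 1 (fun z : ℝ × ℝ × ℝ × ℝ => z.2.1) z := contDiffAt_snd.fst
    have f3 : ContDiffAt ℝ 1 (fun z : ℝ × ℝ × ℝ × ℝ => z.2.2.1) z := contDiffAt_snd.snd.fst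
    have f4 : ContDiffAt ℝ 1 (fun z : ℝ × ℝ × ℝ × ℝ => z.2.2.2) z := contDiffAt_snd.snd.snd
    have fY := (f1.pow 2).add (f2.pow 2)
    exact (((f3.div fY hY.ne').sub ((contDiffAt_const.mul (f2.pow 2)).div (f1.mul fY) (mul_pos hu hY).ne')).sub
      (f1.div fY hY.ne')).add ((contDiffAt_const.mul (fY.sqrt hY.ne')).div (f1.mul f4) (mul_pos hu hL).ne')
  obtain ⟨C, hC⟩ := hsm.exists_lipschitzOnWith (by simp) hconv hcomp
  refine ⟨C, C.2, ?_⟩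
  intro u q A L u' q' A' L' hu hu' hL hL' hq hq' hA hA'
  have := hC.dist_le_mul (u, q, A, L) ⟨hu, hq, hA, hL⟩ (u', q', A', L') ⟨hu', hq', hA', hL'⟩
  rw [Real.dist_eq] at this
  refine this.trans (mul_le_mul_of_nonneg_left ?_ C.2)
  simp only [Prod.dist_eq, Real.dist_eq]
  have a1 := abs_nonneg (u - u')
  have a2 := abs_nonneg (q - q')
  have a3 := abs_nonneg (A - A')
  have a4 := abs_nonneg (L - L')
  refine max_le ?_ (max_le ?_ (max_le ?_ ?_)) <;> linarith

end GP

namespace GP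

theorem radial_unique {r r' : ℝ → ℝ → ℝ} {ω : ℝ}
    (h1 : ContDiffOn ℝ (⊤ : ℕ∞) (fun p : ℝ × ℝ => r p.1 p.2) (Set.univ ×ˢ Set.Ico 0 ω))
    (h2 : ∀ θ : ℝ, ∀ t ∈ Set.Ico (0:ℝ) ω, 0 < r θ t)
    (h3 : ∀ t ∈ Set.Ico (0:ℝ) ω, Function.Periodic (fun θ => r θ t) (2 * π))
    (h4 : RadialGAPF r (Set.Ico 0 ω))
    (h1' : ContDiffOn ℝ (⊤ : ℕ∞) (fun p : ℝ × ℝ => r' p.1 p.2) (Set.univ ×ˢ Set.Ico 0 ω))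
    (h2' : ∀ θ : ℝ, ∀ t ∈ Set.Ico (0:ℝ) ω, 0 < r' θ t)
    (h3' : ∀ t ∈ Set.Ico (0:ℝ) ω, Function.Periodic (fun θ => r' θ t) (2 * π))
    (h4' : RadialGAPF r' (Set.Ico 0 ω)) (h0 : ∀ θ, r θ 0 = r' θ 0) :
    ∀ θ : ℝ, ∀ t ∈ Set.Ico (0:ℝ) ω, r θ t = r' θ t := by
  intro θ t₀ ht₀
  set T := (t₀ + ω) / 2 with hTdef
  have hT : 0 < T := by have := ht₀.1; have := ht₀.2; rw [hTdef]; linarith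
  have hTω : T < ω := by have := ht₀.2; rw [hTdef]; linarith
  have ht₀T : t₀ ∈ Icc 0 T := ⟨ht₀.1, by have := ht₀.2; rw [hTdef]; linarith⟩
  obtain ⟨u, u1, u2, L, cu, cu1, cu2, cL, eu, du, du1, pu, pL, hL, peru, peru1, dtu⟩ := sol_data hT hTω h1 h2 h3 h4
  obtain ⟨v, v1, v2, L', cv, cv1, cv2, cL', ev, dv, dv1, pv, pL', hL', perv, perv1, dtv⟩ :=
    sol_data hT hTω h1' h2' h3' h4'
  have cLp : Continuous fun p : ℝ × ℝ => L p.2 := cL.comp continuous_snd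
  have cLp' : Continuous fun p : ℝ × ℝ => L' p.2 := cL'.comp continuous_snd
  have hYu : ∀ x t, 0 < u x t ^ 2 + u1 x t ^ 2 := fun x t => by have := pu x t; positivity
  have hYv : ∀ x t, 0 < v x t ^ 2 + v1 x t ^ 2 := fun x t => by have := pv x t; positivity
  have cGG : ∀ {a b c : ℝ → ℝ → ℝ} {l : ℝ → ℝ}, (Continuous fun p : ℝ × ℝ => a p.1 p.2) →
      (Continuous fun p : ℝ × ℝ => b p.1 p.2) → (Continuous fun p : ℝ × ℝ => c p.1 p.2) → Continuous l →
      (∀ x t, 0 < a x t) → (∀ t, 0 < l t) →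
      Continuous fun p : ℝ × ℝ => GG (a p.1 p.2) (b p.1 p.2) (c p.1 p.2) (l p.2) := by
    intro a b c l ha hb hc hl pa pl
    have hY : ∀ x t, 0 < a x t ^ 2 + b x t ^ 2 := fun x t => by have := pa x t; positivity
    have cY := (ha.pow 2).add (hb.pow 2)
    unfold GG
    exact (((hc.div cY fun p => (hY p.1 p.2).ne').sub ((continuous_const.mul (hb.pow 2)).div (ha.mul cY)
      fun p => (mul_pos (pa p.1 p.2) (hY p.1 p.2)).ne')).sub (ha.div cY fun p => (hY p.1 p.2).ne')).add
      ((continuous_const.mul cY.sqrt).div (ha.mul (hl.comp continuous_snd)) fun p => (mul_pos (pa p.1 p.2) (pl p.2)).ne')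
  set A : ℝ → ℝ → ℝ := fun x t => (u x t ^ 2 + u1 x t ^ 2)⁻¹ with hA
  set A1 : ℝ → ℝ → ℝ := fun x t => -(2 * u x t * u1 x t + 2 * u1 x t * u2 x t) / (u x t ^ 2 + u1 x t ^ 2) ^ 2 with hA1
  have cY := (cu.pow 2).add (cu1.pow 2)
  have cA : Continuous fun p : ℝ × ℝ => A p.1 p.2 := cY.inv₀ fun p => (hYu p.1 p.2).ne'
  have cA1 : Continuous fun p : ℝ × ℝ => A1 p.1 p.2 :=
    ((((continuous_const.mul cu).mul cu1).add ((continuous_const.mul cu1).mul cu2)).neg).div (cY.pow 2)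
      fun p => (pow_pos (hYu p.1 p.2) 2).ne'
  have dA : ∀ x t, HasDerivAt (fun x => A x t) (A1 x t) x := by
    intro x t
    have := (((du x t).pow 2).add ((du1 x t).pow 2)).inv (hYu x t).ne'
    refine this.congr_deriv ?_
    simp [hA1]
  obtain ⟨c0, hc0, hc0A⟩ := exists_lower cA (fun x t => inv_pos.2 (hYu x t)) T
  obtain ⟨M0, hM0⟩ := exists_upper cA1 T
  obtain ⟨m1, m1p, hm1⟩ := exists_lower cu pu T
  obtain ⟨m2, m2p, hm2⟩ := exists_lower cv pv T
  obtain ⟨m3, m3p, hm3⟩ := exists_lower (f := fun _ t => L t) cLp (fun _ t => pL t) T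
  obtain ⟨m4, m4p, hm4⟩ := exists_lower (f := fun _ t => L' t) cLp' (fun _ t => pL' t) T
  obtain ⟨M1, hM1⟩ := exists_upper cu T
  obtain ⟨M2, hM2⟩ := exists_upper cv T
  obtain ⟨M3, hM3⟩ := exists_upper (f := fun _ t => L t) cLp T
  obtain ⟨M4, hM4⟩ := exists_upper (f := fun _ t => L' t) cLp' T
  obtain ⟨M5, hM5⟩ := exists_upper cu1 T
  obtain ⟨M6, hM6⟩ := exists_upper cv1 T
  obtain ⟨M7, hM7⟩ := exists_upper cv2 T
  set m := min (min m1 m2) (min m3 m4) with hm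
  have hmp : 0 < m := lt_min (lt_min m1p m2p) (lt_min m3p m4p)
  obtain ⟨M, hM⟩ : ∃ M, ∀ k ∈ ({M1, M2, M3, M4, M5, M6, M7} : Finset ℝ), k ≤ M := Finset.exists_le _
  obtain ⟨C, hC, hlip⟩ := GG_lipschitz (M := M) hmp
  have hz := energy_zero hT (fun x t => u x t - v x t) (fun x t => u1 x t - v1 x t) (fun x t => u2 x t - v2 x t)
    (fun x t => GG (u x t) (u1 x t) (u2 x t) (L t) - GG (v x t) (v1 x t) (v2 x t) (L' t)) A A1
    (cu.sub cv) (cu1.sub cv1) (cu2.sub cv2) ((cGG cu cu1 cu2 cL pu pL).sub (cGG cv cv1 cv2 cL' pv pL')) cA cA1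
    (fun x t _ => (du x t).sub (dv x t)) (fun x t _ => (du1 x t).sub (dv1 x t)) (fun x t _ => dA x t)
    (fun x t ht => (dtu x t ht).sub (dtv x t ht)) (fun t _ => by rw [peru, perv]) (fun t _ => by rw [peru1, perv1])
    (fun t _ => by simp only [hA]; rw [peru, peru1]) hc0 hC hc0A hM0 (fun x hx t ht => by
      have e : GG (u x t) (u1 x t) (u2 x t) (L t) - GG (v x t) (v1 x t) (v2 x t) (L' t) - A x t * (u2 x t - v2 x t) =
          GG (u x t) (u1 x t) (v2 x t) (L t) - GG (v x t) (v1 x t) (v2 x t) (L' t) := by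
        simp only [GG, hA]
        ring
      rw [e]
      have b1 := (hM1 x hx t ht).trans (hM M1 (by simp))
      have b2 := (hM2 x hx t ht).trans (hM M2 (by simp))
      have b3 := (hM3 x hx t ht).trans (hM M3 (by simp))
      have b4 := (hM4 x hx t ht).trans (hM M4 (by simp))
      have b5 := (hM5 x hx t ht).trans (hM M5 (by simp))
      have b6 := (hM6 x hx t ht).trans (hM M6 (by simp))
      have b7 := (hM7 x hx t ht).trans (hM M7 (by simp))
      have l1 : m ≤ u x t := ((min_le_left _ _).trans (min_le_left _ _)).trans (hm1 x hx t ht)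
      have l2 : m ≤ v x t := ((min_le_left _ _).trans (min_le_right _ _)).trans (hm2 x hx t ht)
      have l3 : m ≤ L t := ((min_le_right _ _).trans (min_le_left _ _)).trans (hm3 x hx t ht)
      have l4 : m ≤ L' t := ((min_le_right _ _).trans (min_le_right _ _)).trans (hm4 x hx t ht)
      have hl := hlip _ _ _ _ _ _ _ _ ⟨l1, (abs_le.1 b1).2⟩ ⟨l2, (abs_le.1 b2).2⟩ ⟨l3, (abs_le.1 b3).2⟩
        ⟨l4, (abs_le.1 b4).2⟩ (abs_le.1 b5) (abs_le.1 b6) (abs_le.1 b7) (abs_le.1 b7)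
      refine hl.trans (mul_le_mul_of_nonneg_left ?_ hC)
      rw [sub_self, abs_zero, add_zero]
      gcongr
      have sec : ∀ {u : ℝ → ℝ → ℝ}, (Continuous fun p : ℝ × ℝ => u p.1 p.2) → Continuous fun x => u x t :=
        fun hu => hu.comp (Continuous.prodMk_left t)
      have su : Continuous fun x => √(u x t ^ 2 + u1 x t ^ 2) := (((sec cu).pow 2).add ((sec cu1).pow 2)).sqrt
      have sv : Continuous fun x => √(v x t ^ 2 + v1 x t ^ 2) := (((sec cv).pow 2).add ((sec cv1).pow 2)).sqrt
      have hp : 0 ≤ 2 * π := by positivity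
      rw [hL, hL', ← intervalIntegral.integral_sub (su.intervalIntegrable _ _) (sv.intervalIntegrable _ _)]
      refine (intervalIntegral.abs_integral_le_integral_abs hp).trans ?_
      refine intervalIntegral.integral_mono_on hp ((su.sub sv).abs.intervalIntegrable _ _)
        ((((sec cu).sub (sec cv)).abs.add ((sec cu1).sub (sec cv1)).abs).intervalIntegrable _ _) fun x _ => ?_
      exact sqrt_diff_le _ _ _ _)
    (fun x => by
      rw [eu x 0 ⟨le_rfl, hT.le⟩, ev x 0 ⟨le_rfl, hT.le⟩, h0, sub_self])
  have hper : Function.Periodic (fun θ => r θ t₀ - r' θ t₀) (2 * π) := fun θ => by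
    have e1 := h3 t₀ ht₀ θ
    have e2 := h3' t₀ ht₀ θ
    simp only at e1 e2 ⊢
    rw [e1, e2]
  obtain ⟨y, hy, hye⟩ := hper.exists_mem_Ico₀ (by positivity) θ
  have := hz y ⟨hy.1, hy.2.le⟩ t₀ ht₀T
  replace this : u y t₀ - v y t₀ = 0 := this
  replace hye : r θ t₀ - r' θ t₀ = r y t₀ - r' y t₀ := hye
  rw [eu y t₀ ht₀T, ev y t₀ ht₀T] at this
  rw [this] at hye
  linarith

end GP

namespace GP

theorem flow_exists {r : ℝ → ℝ → ℝ} {r₀ : ℝ → ℝ} {ω : ℝ}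
    (h1 : ContDiffOn ℝ (⊤ : ℕ∞) (fun p : ℝ × ℝ => r p.1 p.2) (Set.univ ×ˢ Set.Ico 0 ω))
    (h2 : ∀ θ : ℝ, ∀ t ∈ Set.Ico (0:ℝ) ω, 0 < r θ t)
    (h3 : ∀ t ∈ Set.Ico (0:ℝ) ω, Function.Periodic (fun θ => r θ t) (2 * π))
    (h0 : ∀ θ, r θ 0 = r₀ θ) (h4 : RadialGAPF r (Set.Ico 0 ω)) :
    ∃ X : ℝ → ℝ → ℝ × ℝ,
        IsGAPFSolutionOn X (fun θ => r₀ θ • ((Real.cos θ, Real.sin θ) : ℝ × ℝ)) (Set.Ico 0 ω) := by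
  set X : ℝ → ℝ → ℝ × ℝ := fun t φ => (r φ t * Real.cos φ, r φ t * Real.sin φ) with hX
  have hI : UniqueDiffOn ℝ (Ico (0:ℝ) ω) := uniqueDiffOn_Ico 0 ω
  obtain ⟨p1, d1⟩ := partial_smooth hI h1
  obtain ⟨p2, d2⟩ := partial_smooth (f := rdθ r) hI p1
  have hX1 : ∀ t ∈ Ico (0:ℝ) ω, ∀ φ, HasDerivAt (X t)
      (rdθ r φ t * Real.cos φ + r φ t * -Real.sin φ, rdθ r φ t * Real.sin φ + r φ t * Real.cos φ) φ := by
    intro t ht φ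
    exact ((d1 φ t ht).mul (Real.hasDerivAt_cos φ)).prodMk ((d1 φ t ht).mul (Real.hasDerivAt_sin φ))
  have hX1' : ∀ t ∈ Ico (0:ℝ) ω, deriv (X t) = fun φ =>
      (rdθ r φ t * Real.cos φ + r φ t * -Real.sin φ, rdθ r φ t * Real.sin φ + r φ t * Real.cos φ) :=
    fun t ht => funext fun φ => (hX1 t ht φ).deriv
  have hX2 : ∀ t ∈ Ico (0:ℝ) ω, ∀ φ, deriv (deriv (X t)) φ =
      (rdθθ r φ t * Real.cos φ + rdθ r φ t * -Real.sin φ + (rdθ r φ t * -Real.sin φ + r φ t * -Real.cos φ),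
       rdθθ r φ t * Real.sin φ + rdθ r φ t * Real.cos φ + (rdθ r φ t * Real.cos φ + r φ t * -Real.sin φ)) := by
    intro t ht φ
    rw [hX1' t ht]
    have k2 : HasDerivAt (fun u => rdθ r u t) (rdθθ r φ t) φ := d2 φ t ht
    have k1 : HasDerivAt (fun u => r u t) (rdθ r φ t) φ := d1 φ t ht
    exact (((k2.mul (Real.hasDerivAt_cos φ)).add (k1.mul (Real.hasDerivAt_sin φ).neg)).prodMk
      ((k2.mul (Real.hasDerivAt_sin φ)).add (k1.mul (Real.hasDerivAt_cos φ)))).deriv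
  have hnorm : ∀ t ∈ Ico (0:ℝ) ω, ∀ φ, vnorm (deriv (X t) φ) = rmet r φ t := by
    intro t ht φ
    rw [hX1' t ht, vnorm, rmet]
    congr 1
    have := Real.sin_sq_add_cos_sq φ
    simp only
    linear_combination (r φ t ^ 2 + rdθ r φ t ^ 2) * this
  have hY : ∀ t ∈ Ico (0:ℝ) ω, ∀ φ, 0 < r φ t ^ 2 + rdθ r φ t ^ 2 := fun t ht φ => by
    have := h2 φ t ht; positivity
  have hg : ∀ t ∈ Ico (0:ℝ) ω, ∀ φ, 0 < rmet r φ t := fun t ht φ => Real.sqrt_pos.2 (hY t ht φ)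
  have hlen : ∀ t ∈ Ico (0:ℝ) ω, clen (X t) = rlen r t := by
    intro t ht
    rw [clen, rlen]
    congr 1; funext φ; exact hnorm t ht φ
  have hdet : ∀ t ∈ Ico (0:ℝ) ω, ∀ φ, vdet (deriv (X t) φ) (deriv (deriv (X t)) φ) =
      r φ t ^ 2 + 2 * rdθ r φ t ^ 2 - r φ t * rdθθ r φ t := by
    intro t ht φ
    rw [hX2 t ht, hX1' t ht, vdet]
    have := Real.sin_sq_add_cos_sq φ
    simp only
    linear_combination (r φ t ^ 2 + 2 * rdθ r φ t ^ 2 - r φ t * rdθθ r φ t) * this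
  have hXs : ∀ t φ, X t φ = r φ t • ((Real.cos φ, Real.sin φ) : ℝ × ℝ) := fun t φ => by
    simp [hX]
  refine ⟨X, ⟨fun φ => ?_, fun t ht => ⟨?_, fun φ => ?_, fun φ h => ?_⟩, ?_, ?_⟩⟩
  · rw [hXs, h0]
  · have hr : ContDiff ℝ (⊤ : ℕ∞) fun φ => r φ t := by
      rw [← contDiffOn_univ]
      exact h1.comp (f := fun φ : ℝ => (φ, t)) (contDiff_id.prodMk contDiff_const).contDiffOn
        (fun φ _ => mk_mem_prod (mem_univ φ) ht)
    exact (hr.mul Real.contDiff_cos).prodMk (hr.mul Real.contDiff_sin)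
  · have := h3 t ht φ
    simp only [hX] at this ⊢
    rw [this, Real.cos_add_two_pi, Real.sin_add_two_pi]
  · have h5 := hnorm t ht φ
    rw [h] at h5
    have := hg t ht φ
    rw [← h5] at this
    simp [vnorm] at this
  · have hr : ContDiffOn ℝ (⊤ : ℕ∞) (fun p : ℝ × ℝ => r p.2 p.1) (Ico 0 ω ×ˢ univ) :=
      h1.comp (f := fun p : ℝ × ℝ => (p.2, p.1)) (contDiff_snd.prodMk contDiff_fst).contDiffOn
        (fun p hp => ⟨mem_univ _, hp.1⟩)
    exact (hr.mul (Real.contDiff_cos.comp contDiff_snd).contDiffOn).prodMk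
      (hr.mul (Real.contDiff_sin.comp contDiff_snd).contDiffOn)
  · refine ⟨fun t φ => -(curv (X t) φ - 2 * π / clen (X t)) * rdθ r φ t / r φ t, fun t ht φ => ?_⟩
    have k := h4 t ht φ
    have k2 := (k.mul_const (Real.cos φ)).prodMk (k.mul_const (Real.sin φ))
    refine HasDerivWithinAt.congr_deriv k2 ?_
    have hrp := h2 φ t ht
    have hgp := hg t ht φ
    have hgsq : rmet r φ t ^ 2 = r φ t ^ 2 + rdθ r φ t ^ 2 := Real.sq_sqrt (hY t ht φ).le
    set β := curv (X t) φ - 2 * π / clen (X t) with hβ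
    have hrt : rdθθ r φ t / rmet r φ t ^ 2 - 2 / (r φ t * rmet r φ t ^ 2) * rdθ r φ t ^ 2
        - r φ t / rmet r φ t ^ 2 + 2 * π * rmet r φ t / (r φ t * rlen r t) = -(β * rmet r φ t / r φ t) := by
      rw [hβ, curv, hdet t ht, hnorm t ht, hlen t ht]
      by_cases hl : rlen r t = 0
      · rw [hl]; simp; field_simp; ring
      · field_simp; ring
    rw [hrt]
    have hT : unitTangent (X t) φ = (rmet r φ t)⁻¹ •
      (rdθ r φ t * Real.cos φ + r φ t * -Real.sin φ, rdθ r φ t * Real.sin φ + r φ t * Real.cos φ) := by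
      rw [unitTangent, hnorm t ht, hX1' t ht]
    rw [innerNormal, hT]
    simp only [Prod.smul_mk, Prod.mk_add_mk, smul_eq_mul]
    rw [← hβ]
    generalize β = b at *
    generalize rmet r φ t = g at *
    generalize rdθ r φ t = q at *
    generalize r φ t = ρ at *
    clear hrt k k2
    ext
    · simp only
      field_simp
      linear_combination (-b * Real.cos φ) * hgsq
    · simp only
      field_simp
      linear_combination (-b * Real.sin φ) * hgsq

end GP

/-- Short time existence and uniqueness for the radial Cauchy problem of Gage's
area-preserving flow with smooth positive `2π`-periodic initial value `r₀`;
consequently the flow with the star-shaped initial curve `θ ↦ r₀(θ)(cos θ, sin θ)`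
has a smooth solution on some interval `[0, ω)`, `ω > 0`. -/
theorem radial_gapf_short_time_existence_uniqueness
    (r₀ : ℝ → ℝ) (hsmooth : ContDiff ℝ (⊤ : ℕ∞) r₀)
    (hpos : ∀ θ, 0 < r₀ θ) (hper : Function.Periodic r₀ (2 * π)) :
    ∃ ω > (0:ℝ),
      (∃ r : ℝ → ℝ → ℝ,
        (ContDiffOn ℝ (⊤ : ℕ∞) (fun p : ℝ × ℝ => r p.1 p.2)
            (Set.univ ×ˢ Set.Ico 0 ω) ∧
          (∀ θ : ℝ, ∀ t ∈ Set.Ico (0:ℝ) ω, 0 < r θ t) ∧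
          (∀ t ∈ Set.Ico (0:ℝ) ω, Function.Periodic (fun θ => r θ t) (2 * π)) ∧
          (∀ θ, r θ 0 = r₀ θ) ∧
          RadialGAPF r (Set.Ico 0 ω)) ∧
        (∀ r' : ℝ → ℝ → ℝ,
          (ContDiffOn ℝ (⊤ : ℕ∞) (fun p : ℝ × ℝ => r' p.1 p.2)
              (Set.univ ×ˢ Set.Ico 0 ω) ∧
            (∀ θ : ℝ, ∀ t ∈ Set.Ico (0:ℝ) ω, 0 < r' θ t) ∧
            (∀ t ∈ Set.Ico (0:ℝ) ω, Function.Periodic (fun θ => r' θ t) (2 * π)) ∧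
            (∀ θ, r' θ 0 = r₀ θ) ∧
            RadialGAPF r' (Set.Ico 0 ω)) →
          ∀ θ : ℝ, ∀ t ∈ Set.Ico (0:ℝ) ω, r' θ t = r θ t)) ∧
      (∃ X : ℝ → ℝ → ℝ × ℝ,
        IsGAPFSolutionOn X (fun θ => r₀ θ • ((Real.cos θ, Real.sin θ) : ℝ × ℝ))
          (Set.Ico 0 ω)) := by
  obtain ⟨ω, hω, r, h1, h2, h3, h0, h4⟩ := GP.radial_exists r₀ hsmooth hpos hper
  refine ⟨ω, hω, ⟨r, ⟨h1, h2, h3, h0, h4⟩, ?_⟩, GP.flow_exists h1 h2 h3 h0 h4⟩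
  rintro r' ⟨k1, k2, k3, k0, k4⟩ θ t ht
  exact GP.radial_unique k1 k2 k3 k4 h1 h2 h3 h4 (fun θ => (k0 θ).trans (h0 θ).symm) θ t ht
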